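/- arXiv:0903.0560 — 3 statements merged into one kernel-verified Lean document; each statement's English description precedes it below -/
import Mathlib

section
/- Every finitely generated solvable group R that is not virtually nilpotent contains a subgroup R' of finite index which admits a metabelian quotient Q' that is not virtually nilpotent. (Théorème 4.3, [De 06, théorème 3.2].) -/
/-- A group is virtually nilpotent if it has a nilpotent subgroup of finite index. -/
def VirtuallyNilpotent (G : Type*) [Group G] : Prop :=
  ∃ H : Subgroup G, H.FiniteIndex ∧ Group.IsNilpotent ↥H

section GenericFreeness

variable {J M : Type*} [CommRing J] [AddCommGroup M] [Module J M]

/-- The family of elements of `B` is linearly independent modulo the submodule `U`. -/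
def IndepMod (U : Submodule J M) (B : Set M) : Prop :=
  ∀ l : M →₀ J, (l.support : Set M) ⊆ B → Finsupp.linearCombination J id l ∈ U → l = 0

/-- The quotient `V / U` becomes free after inverting `s`. -/
def FreeAway (s : J) (U V : Submodule J M) : Prop :=
  ∃ B : Set M, B ⊆ V ∧ IndepMod U B ∧ ∀ v ∈ V, ∃ k : ℕ, s ^ k • v ∈ U ⊔ Submodule.span J B

lemma linearCombination_id_mem {V : Submodule J M} {l : M →₀ J}
    (h : (l.support : Set M) ⊆ V) : Finsupp.linearCombination J id l ∈ V := by
  rw [Finsupp.linearCombination_apply]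
  exact Submodule.sum_mem _ fun b hb => V.smul_mem _ (h hb)

lemma sup_span_mono {U : Submodule J M} {B B' : Set M} (h : B ⊆ B') :
    U ⊔ Submodule.span J B ≤ U ⊔ Submodule.span J B' :=
  sup_le_sup_left (Submodule.span_mono h) U

lemma IndepMod.union {U V : Submodule J M} {B₁ B₂ : Set M} (hUV : U ≤ V) (hB₁ : B₁ ⊆ V)
    (h₁ : IndepMod U B₁) (h₂ : IndepMod V B₂) : IndepMod U (B₁ ∪ B₂) := by
  classical
  intro l hl hU
  have hsplit := Finsupp.filter_add_filter_not l (· ∈ B₁)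
  have hmem : Finsupp.linearCombination J id (l.filter (· ∈ B₁)) ∈ V := by
    refine linearCombination_id_mem fun b hb => hB₁ ?_
    rw [Finset.mem_coe, Finsupp.support_filter, Finset.mem_filter] at hb
    exact hb.2
  have h0 : l.filter (fun b => ¬ b ∈ B₁) = 0 := by
    refine h₂ _ (fun b hb => ?_) ?_
    · rw [Finset.mem_coe, Finsupp.support_filter, Finset.mem_filter] at hb
      exact (hl hb.1).resolve_left hb.2
    · rw [← hsplit, map_add] at hU
      exact (V.add_mem_iff_right hmem).1 (hUV hU)
  refine h₁ l (fun b hb => ?_) hU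
  by_contra hb'
  have := DFunLike.congr_fun h0 b
  rw [Finsupp.filter_apply_pos (fun b => ¬ b ∈ B₁) l hb'] at this
  exact (Finsupp.mem_support_iff.1 hb) this

lemma FreeAway.refl (s : J) (U : Submodule J M) : FreeAway s U U := by
  refine ⟨∅, by simp, fun l hl _ => ?_, fun v hv => ⟨0, by simpa using hv⟩⟩
  simpa using hl

lemma FreeAway.mono {s t : J} {U V : Submodule J M} (h : FreeAway s U V) (hst : s ∣ t) :
    FreeAway t U V := by
  obtain ⟨B, hB, hi, hs⟩ := h
  refine ⟨B, hB, hi, fun v hv => ?_⟩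
  obtain ⟨k, hk⟩ := hs v hv
  obtain ⟨c, rfl⟩ := hst
  refine ⟨k, ?_⟩
  rw [mul_comm, mul_pow, mul_smul]
  exact Submodule.smul_mem _ _ hk

/-- Free quotients of a chain of submodules glue to a free quotient of the union. -/
lemma FreeAway.iSup {s : J} {X : ℕ → Submodule J M} (hX : Monotone X)
    (h : ∀ n, FreeAway s (X n) (X (n + 1))) : FreeAway s (X 0) (⨆ n, X n) := by
  choose B hB hi hs using h
  have key : ∀ n, (⋃ i ∈ Finset.range n, B i) ⊆ X n ∧
      IndepMod (X 0) (⋃ i ∈ Finset.range n, B i) ∧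
      ∀ v ∈ X n, ∃ k : ℕ, s ^ k • v ∈ X 0 ⊔ Submodule.span J (⋃ i ∈ Finset.range n, B i) := by
    intro n
    induction n with
    | zero =>
      refine ⟨by simp, fun l hl _ => by simpa using hl, fun v hv => ⟨0, by simpa using hv⟩⟩
    | succ n ih =>
      obtain ⟨h1, h2, h3⟩ := ih
      have hU : (⋃ i ∈ Finset.range (n + 1), B i) = (⋃ i ∈ Finset.range n, B i) ∪ B n := by
        rw [Finset.range_add_one, Finset.set_biUnion_insert, Set.union_comm]
      rw [hU]
      refine ⟨Set.union_subset (h1.trans (hX n.le_succ)) (hB n),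
        h2.union (hX n.zero_le) h1 (hi n), fun v hv => ?_⟩
      obtain ⟨k, hk⟩ := hs n v hv
      obtain ⟨a, ha, b, hb, hab⟩ := Submodule.mem_sup.1 hk
      obtain ⟨m, hm⟩ := h3 a ha
      refine ⟨m + k, ?_⟩
      rw [pow_add, mul_smul, ← hab, smul_add]
      refine Submodule.add_mem _ ?_ (Submodule.smul_mem _ _ ?_)
      · exact sup_span_mono Set.subset_union_left hm
      · exact (Submodule.span_mono Set.subset_union_right |>.trans le_sup_right) hb
  refine ⟨⋃ n, ⋃ i ∈ Finset.range n, B i, ?_, fun l hl hU => ?_, fun v hv => ?_⟩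
  · exact Set.iUnion_subset fun n => (key n).1.trans (le_iSup X n)
  · have hdir : Directed (· ⊆ ·) fun n => ⋃ i ∈ Finset.range n, B i := by
      refine (monotone_nat_of_le_succ fun n => ?_).directed_le
      exact Set.biUnion_subset_biUnion_left fun i hi => by
        simp only [Finset.coe_range, Set.mem_Iio] at hi ⊢; exact Nat.lt_succ_of_lt hi
    obtain ⟨n, hn⟩ := hdir.exists_mem_subset_of_finset_subset_biUnion hl
    exact (key n).2.1 l hn hU
  · obtain ⟨n, hn⟩ := (Submodule.mem_iSup_of_directed _ hX.directed_le).1 hv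
    obtain ⟨k, hk⟩ := (key n).2.2 v hn
    exact ⟨k, sup_span_mono (Set.subset_iUnion (fun n => ⋃ i ∈ Finset.range n, B i) n) hk⟩

lemma FreeAway.trans {s : J} {U V W : Submodule J M} (hUV : U ≤ V) (hVW : V ≤ W)
    (h₁ : FreeAway s U V) (h₂ : FreeAway s V W) : FreeAway s U W := by
  let X : ℕ → Submodule J M := fun n => match n with | 0 => U | 1 => V | _ + 2 => W
  have hX : Monotone X := by
    refine monotone_nat_of_le_succ fun n => ?_
    match n with
    | 0 => exact hUV
    | 1 => exact hVW
    | _ + 2 => exact le_rfl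
  have hsup : ⨆ n, X n = W := by
    refine le_antisymm (iSup_le fun n => ?_) (le_iSup X 2)
    match n with
    | 0 => exact hUV.trans hVW
    | 1 => exact hVW
    | _ + 2 => exact le_rfl
  rw [← hsup]
  refine FreeAway.iSup hX fun n => ?_
  match n with
  | 0 => exact h₁
  | 1 => exact h₂
  | _ + 2 => exact FreeAway.refl _ _

/-- Second isomorphism theorem, twisted by an automorphism. -/
lemma FreeAway.sup_map {s : J} {X N : Submodule J M} {e : M →ₗ[J] M} (he : Function.Injective e)
    (h : FreeAway s (N ⊓ X.comap e) N) : FreeAway s X (X ⊔ N.map e) := by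
  obtain ⟨B, hB, hi, hs⟩ := h
  refine ⟨e '' B, ?_, fun l hl hU => ?_, fun v hv => ?_⟩
  · rintro _ ⟨b, hb, rfl⟩
    exact Submodule.mem_sup_right ⟨b, hB hb, rfl⟩
  · have hinj : Set.InjOn e (e ⁻¹' (l.support : Set M)) := he.injOn
    have hl' : Finsupp.mapDomain e (Finsupp.comapDomain e l hinj) = l :=
      Finsupp.mapDomain_comapDomain e he l fun b hb => by
        obtain ⟨b', _, rfl⟩ := hl hb
        exact ⟨b', rfl⟩
    have hsupp : ((Finsupp.comapDomain e l hinj).support : Set M) ⊆ B := by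
      intro b hb
      obtain ⟨b', hb', hbb⟩ := hl (by simpa using hb : e b ∈ (l.support : Set M))
      exact he hbb ▸ hb'
    rw [← hl', hi _ hsupp ⟨linearCombination_id_mem (hsupp.trans hB), ?_⟩, Finsupp.mapDomain_zero]
    rw [← hl', Finsupp.linearCombination_mapDomain] at hU
    rw [SetLike.mem_coe, Submodule.mem_comap]
    convert hU
    rw [Finsupp.apply_linearCombination]
    rfl
  · obtain ⟨x, hx, _, ⟨n, hn, rfl⟩, rfl⟩ := Submodule.mem_sup.1 hv
    obtain ⟨k, hk⟩ := hs n hn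
    obtain ⟨a, ha, b, hb, hab⟩ := Submodule.mem_sup.1 hk
    refine ⟨k, ?_⟩
    rw [smul_add, ← map_smul, ← hab, map_add]
    refine Submodule.add_mem _ (Submodule.mem_sup_left (Submodule.smul_mem _ _ hx))
      (Submodule.add_mem_sup ha.2 ?_)
    rw [Submodule.span_image]
    exact ⟨b, hb, rfl⟩

lemma exists_freeAway_sup_span_singleton [IsDomain J] (X : Submodule J M) (f : M) :
    ∃ s : J, s ≠ 0 ∧ FreeAway s X (X ⊔ Submodule.span J {f}) := by
  by_cases h : ∃ s : J, s ≠ 0 ∧ s • f ∈ X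
  · obtain ⟨s, hs, hf⟩ := h
    refine ⟨s, hs, ∅, by simp, fun l hl _ => by simpa using hl, fun v hv => ⟨1, ?_⟩⟩
    obtain ⟨x, hx, y, hy, rfl⟩ := Submodule.mem_sup.1 hv
    obtain ⟨c, rfl⟩ := Submodule.mem_span_singleton.1 hy
    rw [pow_one, smul_add, smul_comm s c]
    exact Submodule.mem_sup_left (X.add_mem (X.smul_mem _ hx) (X.smul_mem _ hf))
  · push Not at h
    refine ⟨1, one_ne_zero, {f}, ?_, fun l hl hU => ?_, fun v hv => ⟨0, by simpa using hv⟩⟩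
    · exact Submodule.subset_span.trans (SetLike.coe_subset_coe.2 le_sup_right)
    · have hl' := Finsupp.support_subset_singleton.1 (Finset.coe_subset.1 (by simpa using hl) :
        l.support ⊆ {f})
      rw [hl', Finsupp.linearCombination_single] at hU
      by_contra hne
      refine h (l f) (fun h0 => hne ?_) hU
      rw [hl', h0, Finsupp.single_zero]

lemma exists_freeAway_sup_span [IsDomain J] (U : Submodule J M) {F : Set M} (hF : F.Finite) :
    ∃ s : J, s ≠ 0 ∧ FreeAway s U (U ⊔ Submodule.span J F) := by
  induction F, hF using Set.Finite.induction_on with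
  | empty => exact ⟨1, one_ne_zero, by simpa using FreeAway.refl 1 U⟩
  | @insert f F _ _ ih =>
    obtain ⟨s, hs, h⟩ := ih
    obtain ⟨t, ht, h'⟩ := exists_freeAway_sup_span_singleton (U ⊔ Submodule.span J F) f
    refine ⟨s * t, mul_ne_zero hs ht, ?_⟩
    rw [Submodule.span_insert, sup_comm (Submodule.span J {f}), ← sup_assoc]
    exact (h.mono (dvd_mul_right s t)).trans le_sup_left le_sup_left (h'.mono (dvd_mul_left t s))

end GenericFreeness

section Polycyclic

variable {H : Type*} [Group H]

/-- Subgroups obtained from the trivial one by finitely many cyclic extensions. -/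
inductive IsPolycyclic : Subgroup H → Prop
  | bot : IsPolycyclic ⊥
  | sup_zpowers (K : Subgroup H) (x : H) (hK : IsPolycyclic K)
      (hx : x ∈ Subgroup.normalizer (K : Set H)) : IsPolycyclic (K ⊔ Subgroup.zpowers x)

lemma conj_zpow_mem {K : Subgroup H} {x : H} (hx : x ∈ Subgroup.normalizer (K : Set H)) (i : ℤ)
    {k : H} (hk : k ∈ K) : x ^ (-i) * k * x ^ i ∈ K := by
  have := (Subgroup.mem_normalizer_iff.1 (Subgroup.zpow_mem _ hx (-i)) k).1 hk
  rwa [zpow_neg, inv_inv, ← zpow_neg] at this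

lemma mem_sup_zpowers_iff {K : Subgroup H} {x : H}
    (hx : x ∈ Subgroup.normalizer (K : Set H)) {g : H} :
    g ∈ K ⊔ Subgroup.zpowers x ↔ ∃ i : ℤ, ∃ k ∈ K, g = x ^ i * k := by
  constructor
  · intro hg
    rw [Subgroup.sup_eq_closure] at hg
    induction hg using Subgroup.closure_induction with
    | mem g hg =>
      rcases hg with hg | hg
      · exact ⟨0, g, hg, by simp⟩
      · obtain ⟨i, rfl⟩ := Subgroup.mem_zpowers_iff.1 hg
        exact ⟨i, 1, K.one_mem, by simp⟩
    | one => exact ⟨0, 1, K.one_mem, by simp⟩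
    | mul a b _ _ ha hb =>
      obtain ⟨i, k, hk, rfl⟩ := ha
      obtain ⟨j, l, hl, rfl⟩ := hb
      refine ⟨i + j, _, K.mul_mem (conj_zpow_mem hx j hk) hl, ?_⟩
      group
    | inv a _ ha =>
      obtain ⟨i, k, hk, rfl⟩ := ha
      refine ⟨-i, _, conj_zpow_mem hx (-i) (K.inv_mem hk), ?_⟩
      group
  · rintro ⟨i, k, hk, rfl⟩
    exact Subgroup.mul_mem _ (Subgroup.mem_sup_right (Subgroup.zpow_mem_zpowers x i))
      (Subgroup.mem_sup_left hk)

end Polycyclic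

section Leading

variable {J M : Type*} [CommRing J] [AddCommGroup M] [Module J M]

/-- The sum of the first `n` translates of `N` under the powers of `e`. -/
def stage (e : Module.End J M) (N : Submodule J M) : ℕ → Submodule J M
  | 0 => ⊥
  | n + 1 => stage e N n ⊔ N.map (e ^ n)

/-- The leading coefficients in `N` of the elements of `L` of degree at most `n`. -/
def leading (e : Module.End J M) (N L : Submodule J M) (n : ℕ) : Submodule J M :=
  N ⊓ (L ⊔ stage e N n).comap (e ^ n)

lemma stage_succ_eq (e : Module.End J M) (N : Submodule J M) (n : ℕ) :
    stage e N (n + 1) = N ⊔ (stage e N n).map e := by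
  induction n with
  | zero =>
    have : N.map (1 : Module.End J M) = N := Submodule.map_id N
    simp [stage, this]
  | succ n ih =>
    change stage e N (n + 1) ⊔ N.map (e ^ (n + 1)) = N ⊔ (stage e N n ⊔ N.map (e ^ n)).map e
    rw [ih, Submodule.map_sup, sup_assoc, pow_succ', Module.End.mul_eq_comp,
      Submodule.map_comp]

lemma stage_mono (e : Module.End J M) (N : Submodule J M) : Monotone (stage e N) :=
  monotone_nat_of_le_succ fun _ => le_sup_left

lemma map_pow_le_stage (e : Module.End J M) (N : Submodule J M) (n : ℕ) :
    N.map (e ^ n) ≤ stage e N (n + 1) := le_sup_right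

lemma map_stage_le (e : Module.End J M) (N : Submodule J M) (n : ℕ) :
    (stage e N n).map e ≤ stage e N (n + 1) := by
  rw [stage_succ_eq]
  exact le_sup_right

lemma iSup_stage_eq (e : Module.End J M) (N : Submodule J M) :
    ⨆ n, stage e N n = N ⊔ (⨆ n, stage e N n).map e := by
  apply le_antisymm
  · refine iSup_le fun n => (stage_mono e N n.le_succ).trans ?_
    rw [Nat.succ_eq_add_one, stage_succ_eq]
    exact sup_le_sup_left (Submodule.map_mono (le_iSup _ n)) _
  · refine sup_le ?_ ?_
    · refine le_trans ?_ (le_iSup _ 1)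
      rw [stage_succ_eq]
      exact le_sup_left
    · rw [Submodule.map_iSup]
      exact iSup_le fun n => (map_stage_le e N n).trans (le_iSup _ (n + 1))

lemma leading_le (e : Module.End J M) (N L : Submodule J M) (n : ℕ) : leading e N L n ≤ N :=
  inf_le_left

lemma leading_monotone {e : Module.End J M} (N : Submodule J M) {L : Submodule J M}
    (hL : L.map e ≤ L) : Monotone (leading e N L) := by
  refine monotone_nat_of_le_succ fun n => inf_le_inf_left N ?_
  intro v hv
  rw [Submodule.mem_comap] at hv ⊢
  have h : e ((e ^ n) v) ∈ (L ⊔ stage e N n).map e := ⟨_, hv, rfl⟩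
  rw [Submodule.map_sup] at h
  rw [pow_succ']
  exact sup_le_sup hL (map_stage_le e N n) h

lemma leading_mono {e : Module.End J M} (N : Submodule J M) {L L' : Submodule J M} (h : L ≤ L')
    (n : ℕ) : leading e N L n ≤ leading e N L' n :=
  inf_le_inf_left N (Submodule.comap_mono (sup_le_sup_right h _))

lemma inf_stage_le_of_leading_le {e : Module.End J M} {N L L' : Submodule J M} (h : L ≤ L')
    (hlead : ∀ n, leading e N L' n ≤ leading e N L n) (n : ℕ) : L' ⊓ stage e N n ≤ L := by
  induction n with
  | zero => simp [stage]
  | succ n ih =>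
    rintro v ⟨hv, hvs⟩
    obtain ⟨a, ha, _, ⟨c, hc, rfl⟩, rfl⟩ := Submodule.mem_sup.1 hvs
    have hcl : c ∈ leading e N L' n := by
      refine ⟨hc, ?_⟩
      rw [SetLike.mem_coe, Submodule.mem_comap]
      have : (e ^ n) c = (a + (e ^ n) c) + -a := by abel
      rw [this]
      exact Submodule.add_mem_sup hv (Submodule.neg_mem _ ha)
    obtain ⟨l, hl, b, hb, hlb⟩ := Submodule.mem_sup.1 (hlead n hcl).2
    rw [← hlb] at hv ⊢
    have hab : a + b ∈ L := by
      refine ih ⟨?_, Submodule.add_mem _ ha hb⟩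
      have : a + b = (a + (l + b)) - l := by abel
      rw [this]
      exact Submodule.sub_mem _ hv (h hl)
    have : a + (l + b) = (a + b) + l := by abel
    rw [this]
    exact L.add_mem hab hl

end Leading

section Invariant

variable {J M H : Type*} [CommRing J] [AddCommGroup M] [Module J M] [Group H]

/-- The submodule `L` is stable under the subgroup `K`. -/
def IsInvariantUnder (ρ : Representation J H M) (K : Subgroup H) (L : Submodule J M) : Prop :=
  ∀ k ∈ K, ∀ v ∈ L, ρ k v ∈ L

/-- The smallest `K`-stable submodule containing `F`. -/
def orbitSpan (ρ : Representation J H M) (K : Subgroup H) (F : Set M) : Submodule J M :=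
  Submodule.span J {v | ∃ k ∈ K, ∃ f ∈ F, ρ k f = v}

/-- The ascending chain condition for `K`-stable submodules of `V`. -/
def InvariantACC (ρ : Representation J H M) (K : Subgroup H) (V : Submodule J M) : Prop :=
  WellFoundedGT {L : Submodule J M // IsInvariantUnder ρ K L ∧ L ≤ V}

variable {ρ : Representation J H M} {K K' : Subgroup H}

lemma rep_mul_apply (g h : H) (v : M) : ρ (g * h) v = ρ g (ρ h v) := by
  rw [map_mul, Module.End.mul_apply]

lemma rep_inv_apply_self (g : H) (v : M) : ρ g⁻¹ (ρ g v) = v := by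
  rw [← rep_mul_apply, inv_mul_cancel, map_one, Module.End.one_apply]

lemma rep_self_apply_inv (g : H) (v : M) : ρ g (ρ g⁻¹ v) = v := by
  rw [← rep_mul_apply, mul_inv_cancel, map_one, Module.End.one_apply]

lemma rep_injective (ρ : Representation J H M) (g : H) : Function.Injective (ρ g) :=
  Function.LeftInverse.injective (rep_inv_apply_self g)

lemma IsInvariantUnder.mono {L : Submodule J M} (h : IsInvariantUnder ρ K L) (hK : K' ≤ K) :
    IsInvariantUnder ρ K' L := fun k hk => h k (hK hk)

lemma IsInvariantUnder.bot : IsInvariantUnder ρ K ⊥ := by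
  intro k _ v hv
  rw [(Submodule.mem_bot J).1 hv, map_zero]
  exact Submodule.zero_mem _

lemma IsInvariantUnder.sup {L L' : Submodule J M} (h : IsInvariantUnder ρ K L)
    (h' : IsInvariantUnder ρ K L') : IsInvariantUnder ρ K (L ⊔ L') := by
  intro k hk v hv
  obtain ⟨a, ha, b, hb, rfl⟩ := Submodule.mem_sup.1 hv
  rw [map_add]
  exact Submodule.add_mem_sup (h k hk a ha) (h' k hk b hb)

lemma IsInvariantUnder.inf {L L' : Submodule J M} (h : IsInvariantUnder ρ K L)
    (h' : IsInvariantUnder ρ K L') : IsInvariantUnder ρ K (L ⊓ L') :=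
  fun k hk v hv => ⟨h k hk v hv.1, h' k hk v hv.2⟩

lemma IsInvariantUnder.iSup {X : ℕ → Submodule J M} (hX : Monotone X)
    (h : ∀ n, IsInvariantUnder ρ K (X n)) : IsInvariantUnder ρ K (⨆ n, X n) := by
  intro k hk v hv
  obtain ⟨n, hn⟩ := (Submodule.mem_iSup_of_directed _ hX.directed_le).1 hv
  exact le_iSup X n (h n k hk v hn)

lemma IsInvariantUnder.map_zpow {L : Submodule J M} (h : IsInvariantUnder ρ K L) {x : H}
    (hx : x ∈ Subgroup.normalizer (K : Set H)) (i : ℤ) :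
    IsInvariantUnder ρ K (L.map (ρ (x ^ i))) := by
  rintro k hk _ ⟨v, hv, rfl⟩
  refine ⟨_, h _ (conj_zpow_mem hx i hk) v hv, ?_⟩
  rw [← rep_mul_apply, ← rep_mul_apply]
  congr 2
  group

lemma IsInvariantUnder.comap_zpow {L : Submodule J M} (h : IsInvariantUnder ρ K L) {x : H}
    (hx : x ∈ Subgroup.normalizer (K : Set H)) (i : ℤ) :
    IsInvariantUnder ρ K (L.comap (ρ (x ^ i))) := by
  intro k hk v hv
  rw [Submodule.mem_comap] at hv ⊢
  have hk' := conj_zpow_mem hx (-i) hk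
  have := h _ hk' _ hv
  rw [← rep_mul_apply] at this ⊢
  convert this using 3
  group

lemma IsInvariantUnder.stage {N : Submodule J M} (h : IsInvariantUnder ρ K N) {x : H}
    (hx : x ∈ Subgroup.normalizer (K : Set H)) (n : ℕ) :
    IsInvariantUnder ρ K (stage (ρ x) N n) := by
  induction n with
  | zero => exact .bot
  | succ n ih =>
    refine ih.sup ?_
    rw [← map_pow, ← zpow_natCast]
    exact h.map_zpow hx n

lemma IsInvariantUnder.leading {N L : Submodule J M} (h : IsInvariantUnder ρ K N)
    (hL : IsInvariantUnder ρ K L) {x : H} (hx : x ∈ Subgroup.normalizer (K : Set H)) (n : ℕ) :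
    IsInvariantUnder ρ K (leading (ρ x) N L n) := by
  refine h.inf ?_
  rw [← map_pow, ← zpow_natCast]
  exact (hL.sup (h.stage hx n)).comap_zpow hx n

lemma IsInvariantUnder.orbitSpan (F : Set M) : IsInvariantUnder ρ K (orbitSpan ρ K F) := by
  intro k hk v hv
  refine Submodule.span_induction ?_ ?_ ?_ ?_ hv
  · rintro _ ⟨l, hl, f, hf, rfl⟩
    exact Submodule.subset_span ⟨k * l, K.mul_mem hk hl, f, hf, rep_mul_apply k l f⟩
  · rw [map_zero]; exact Submodule.zero_mem _
  · intro a b _ _ ha hb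
    rw [map_add]; exact Submodule.add_mem _ ha hb
  · intro c a _ ha
    rw [map_smul]; exact Submodule.smul_mem _ _ ha

lemma subset_orbitSpan (F : Set M) : F ⊆ orbitSpan ρ K F := fun f hf =>
  Submodule.subset_span ⟨1, K.one_mem, f, hf, by rw [map_one, Module.End.one_apply]⟩

lemma orbitSpan_le {F : Set M} {L : Submodule J M} (hL : IsInvariantUnder ρ K L) (hF : F ⊆ L) :
    orbitSpan ρ K F ≤ L := by
  refine Submodule.span_le.2 ?_
  rintro _ ⟨k, hk, f, hf, rfl⟩
  exact hL k hk f (hF hf)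

lemma orbitSpan_bot (F : Set M) : orbitSpan ρ ⊥ F = Submodule.span J F := by
  refine le_antisymm (orbitSpan_le ?_ Submodule.subset_span)
    (Submodule.span_le.2 (subset_orbitSpan F))
  intro k hk v hv
  rw [Subgroup.mem_bot.1 hk, map_one]
  exact hv

/-- Every vector of the orbit span under `⟨K, x⟩` is pushed into some stage by a power of `x`. -/
lemma exists_mem_stage {F : Set M} {x : H} (hx : x ∈ Subgroup.normalizer (K : Set H)) {v : M}
    (hv : v ∈ orbitSpan ρ (K ⊔ Subgroup.zpowers x) F) :
    ∃ k n : ℕ, ρ (x ^ k) v ∈ stage (ρ x) (orbitSpan ρ K F) n := by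
  have hpush : ∀ {v : M} {k n : ℕ}, ρ (x ^ k) v ∈ stage (ρ x) (orbitSpan ρ K F) n →
      ∀ j : ℕ, ρ (x ^ (j + k)) v ∈ stage (ρ x) (orbitSpan ρ K F) (j + n) := by
    intro v k n h j
    induction j with
    | zero => simpa using h
    | succ j ih =>
      have := map_stage_le (ρ x) _ _ ⟨_, ih, rfl⟩
      rw [← rep_mul_apply, ← pow_succ'] at this
      convert this using 1 <;> grind
  refine Submodule.span_induction ?_ ?_ ?_ ?_ hv
  · rintro _ ⟨g, hg, f, hf, rfl⟩
    obtain ⟨i, k, hk, rfl⟩ := (mem_sup_zpowers_iff hx).1 hg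
    refine ⟨i.natAbs, (i.natAbs + i).toNat + 1, map_pow_le_stage _ _ _ ⟨ρ k f, ?_, ?_⟩⟩
    · exact Submodule.subset_span ⟨k, hk, f, hf, rfl⟩
    · rw [← rep_mul_apply, ← map_pow, ← rep_mul_apply]
      congr 2
      rw [← mul_assoc, ← zpow_natCast, ← zpow_natCast, ← zpow_add]
      congr 2
      omega
  · exact ⟨0, 0, by rw [map_zero]; exact Submodule.zero_mem _⟩
  · rintro a b _ _ ⟨k, n, ha⟩ ⟨l, m, hb⟩
    refine ⟨l + k, max (l + n) (k + m), ?_⟩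
    rw [map_add]
    refine Submodule.add_mem _ (stage_mono _ _ (le_max_left _ _) (hpush ha l)) ?_
    rw [add_comm l k]
    exact stage_mono _ _ (le_max_right _ _) (hpush hb k)
  · rintro c a _ ⟨k, n, ha⟩
    refine ⟨k, n, ?_⟩
    rw [map_smul]
    exact Submodule.smul_mem _ _ ha

lemma wellFoundedGT_orderHom_nat {X : Type*} [PartialOrder X] [WellFoundedGT X] :
    WellFoundedGT (ℕ →o X) := by
  rw [wellFoundedGT_iff_monotone_chain_condition]
  intro f
  have hX := (wellFoundedGT_iff_monotone_chain_condition (α := X)).1 inferInstance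
  obtain ⟨d, hd⟩ := hX ⟨fun k => f k k, fun a b hab =>
    (f.monotone hab a).trans ((f b).monotone hab)⟩
  choose c hc using fun n : ℕ => hX ⟨fun k => f k n, fun a b hab => f.monotone hab n⟩
  refine ⟨d + ∑ i ∈ Finset.range d, c i, fun m hm => OrderHom.ext _ _ (funext fun n => ?_)⟩
  by_cases hn : n < d
  · have hle : c n ≤ d + ∑ i ∈ Finset.range d, c i :=
      (Finset.single_le_sum (fun _ _ => Nat.zero_le _) (Finset.mem_range.2 hn)).trans
        (Nat.le_add_left _ _)
    exact (hc n _ hle).symm.trans (hc n _ (hle.trans hm))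
  · have aux : ∀ k, d ≤ k → f k n = f d d := by
      intro k hk
      push Not at hn
      refine le_antisymm ?_ ((f.monotone hk d).trans ((f k).monotone hn))
      have h1 : f k n ≤ f (max k n) (max k n) :=
        (f.monotone (le_max_left k n) n).trans ((f _).monotone (le_max_right k n))
      exact h1.trans (hd _ (hk.trans (le_max_left k n))).symm.le
    rw [aux _ (Nat.le_add_right _ _), aux _ ((Nat.le_add_right _ _).trans hm)]

/-- **Hall's basis theorem** for modules over polycyclic groups. -/
theorem invariantACC_orbitSpan [IsNoetherianRing J] (ρ : Representation J H M)
    (hK : IsPolycyclic K) {F : Set M} (hF : F.Finite) :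
    InvariantACC ρ K (orbitSpan ρ K F) := by
  induction hK with
  | bot =>
    have : IsNoetherian J (orbitSpan ρ ⊥ F) := by
      rw [orbitSpan_bot]
      exact isNoetherian_span_of_finite J hF
    let φ : {L : Submodule J M // IsInvariantUnder ρ ⊥ L ∧ L ≤ orbitSpan ρ ⊥ F} →
        Submodule J (orbitSpan ρ ⊥ F) := fun L => L.1.submoduleOf _
    have hφ : StrictMono φ := by
      refine Monotone.strictMono_of_injective
        (fun L L' h => Submodule.comap_mono h) fun L L' h => Subtype.ext ?_
      have := congrArg (Submodule.map (Submodule.subtype _)) h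
      simpa only [φ, Submodule.submoduleOf, Submodule.map_comap_subtype,
        inf_eq_right.2 L.2.2, inf_eq_right.2 L'.2.2] using this
    exact hφ.wellFoundedGT
  | sup_zpowers K x hK hx ih =>
    have hN : IsInvariantUnder ρ K (orbitSpan ρ K F) := .orbitSpan F
    have : WellFoundedGT {L : Submodule J M // IsInvariantUnder ρ K L ∧ L ≤ orbitSpan ρ K F} := ih
    have := wellFoundedGT_orderHom_nat
      (X := {L : Submodule J M // IsInvariantUnder ρ K L ∧ L ≤ orbitSpan ρ K F})
    have hxmem : x ∈ K ⊔ Subgroup.zpowers x :=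
      Subgroup.mem_sup_right (Subgroup.mem_zpowers x)
    let φ : {L : Submodule J M // IsInvariantUnder ρ (K ⊔ Subgroup.zpowers x) L ∧
        L ≤ orbitSpan ρ (K ⊔ Subgroup.zpowers x) F} →
        (ℕ →o {L : Submodule J M // IsInvariantUnder ρ K L ∧ L ≤ orbitSpan ρ K F}) := fun L =>
      ⟨fun n => ⟨leading (ρ x) (orbitSpan ρ K F) L n,
        hN.leading (L.2.1.mono le_sup_left) hx n, leading_le _ _ _ _⟩,
        leading_monotone _ (Submodule.map_le_iff_le_comap.2 (L.2.1 x hxmem))⟩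
    have hφ : StrictMono φ := by
      intro L L' hlt
      refine lt_of_le_not_ge (fun n => leading_mono _ hlt.le n) fun hle => hlt.not_ge ?_
      intro v hv
      obtain ⟨k, n, hkn⟩ := exists_mem_stage hx (L'.2.2 hv)
      have h1 : ρ (x ^ k) v ∈ L.1 := inf_stage_le_of_leading_le hlt.le (fun n => hle n) n
        ⟨L'.2.1 _ (Subgroup.pow_mem _ hxmem k) v hv, hkn⟩
      have h2 := L.2.1 _ (Subgroup.inv_mem _ (Subgroup.pow_mem _ hxmem k)) _ h1
      rwa [rep_inv_apply_self] at h2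
    exact hφ.wellFoundedGT

/-- **Hall's generic freeness** for modules over polycyclic groups. -/
theorem exists_freeAway_orbitSpan [IsNoetherianRing J] [IsDomain J] (ρ : Representation J H M)
    (hK : IsPolycyclic K) {F : Set M} (hF : F.Finite) :
    ∀ U : Submodule J M, IsInvariantUnder ρ K U → U ≤ orbitSpan ρ K F →
      ∃ s : J, s ≠ 0 ∧ FreeAway s U (orbitSpan ρ K F) := by
  induction hK with
  | bot =>
    intro U _ hU
    obtain ⟨s, hs, h⟩ := exists_freeAway_sup_span U hF
    refine ⟨s, hs, ?_⟩
    rw [orbitSpan_bot] at hU ⊢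
    rwa [sup_eq_right.2 hU] at h
  | sup_zpowers K x hK hx ih =>
    intro U hUinv hU
    set N := orbitSpan ρ K F with hNdef
    have hN : IsInvariantUnder ρ K N := .orbitSpan F
    have hxmem : x ∈ K ⊔ Subgroup.zpowers x :=
      Subgroup.mem_sup_right (Subgroup.mem_zpowers x)
    have hUK : IsInvariantUnder ρ K U := hUinv.mono le_sup_left
    have hUmap : ∀ i : ℤ, U.map (ρ (x ^ i)) = U := by
      intro i
      refine le_antisymm (Submodule.map_le_iff_le_comap.2
        (hUinv _ (Subgroup.zpow_mem _ hxmem i))) fun u hu => ?_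
      exact ⟨_, hUinv _ (Subgroup.inv_mem _ (Subgroup.zpow_mem _ hxmem i)) u hu,
        rep_self_apply_inv _ u⟩
    set P := ⨆ n, stage (ρ x) N n with hP
    have hPinv : IsInvariantUnder ρ K P := .iSup (stage_mono _ _) fun n => hN.stage hx n
    -- the positive part
    have hstab : ∃ m, ∀ n, m ≤ n → leading (ρ x) N U m = leading (ρ x) N U n := by
      have hacc : WellFoundedGT {L : Submodule J M // IsInvariantUnder ρ K L ∧ L ≤ N} :=
        invariantACC_orbitSpan ρ hK hF
      obtain ⟨m, hm⟩ := wellFoundedGT_iff_monotone_chain_condition.1 hacc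
        ⟨fun n => ⟨leading (ρ x) N U n, hN.leading hUK hx n, leading_le _ _ _ _⟩,
          leading_monotone N (Submodule.map_le_iff_le_comap.2 (hUinv x hxmem))⟩
      exact ⟨m, fun n hn => congrArg Subtype.val (hm n hn)⟩
    obtain ⟨m, hm⟩ := hstab
    choose s hs0 hs using fun n => ih (leading (ρ x) N U n) (hN.leading hUK hx n)
      (leading_le _ _ _ _)
    set t := ∏ n ∈ Finset.range (m + 1), s n with ht
    have ht0 : t ≠ 0 := Finset.prod_ne_zero_iff.2 fun n _ => hs0 n
    have hlead : ∀ n, FreeAway t (leading (ρ x) N U n) N := by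
      intro n
      have hmin : leading (ρ x) N U n = leading (ρ x) N U (min n m) := by
        rcases le_total n m with h | h
        · rw [min_eq_left h]
        · rw [min_eq_right h, hm n h]
      rw [hmin]
      exact (hs _).mono (Finset.dvd_prod_of_mem s (Finset.mem_range.2 (by omega)))
    have hpos : FreeAway t U (U ⊔ P) := by
      have hmono : Monotone fun n => U ⊔ stage (ρ x) N n := fun a b hab =>
        sup_le_sup_left (stage_mono _ _ hab) _
      have := FreeAway.iSup (s := t) hmono fun n => by
        rw [stage, ← sup_assoc]
        refine FreeAway.sup_map ?_ (hlead n)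
        rw [← map_pow]
        exact rep_injective ρ _
      rwa [← sup_iSup, stage, sup_bot_eq] at this
    -- the negative part
    obtain ⟨r, hr0, hr⟩ := ih (N ⊓ (U ⊔ P.map (ρ x)))
      (hN.inf (hUK.sup (by simpa using hPinv.map_zpow hx 1))) inf_le_left
    let X : ℕ → Submodule J M := fun n => U ⊔ P.map (ρ (x ^ (-(n : ℤ))))
    have hXsucc : ∀ n, X (n + 1) = X n ⊔ N.map (ρ (x ^ (-((n + 1 : ℕ) : ℤ)))) := by
      intro n
      have hPeq : P = N ⊔ P.map (ρ x) := iSup_stage_eq (ρ x) N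
      have hexp : (-((n + 1 : ℕ) : ℤ) + 1) = -(n : ℤ) := by push_cast; ring
      have hPmap : P.map (ρ (x ^ (-((n + 1 : ℕ) : ℤ)))) =
          P.map (ρ (x ^ (-(n : ℤ)))) ⊔ N.map (ρ (x ^ (-((n + 1 : ℕ) : ℤ)))) := by
        conv_lhs => rw [hPeq]
        rw [Submodule.map_sup, ← Submodule.map_comp, ← Module.End.mul_eq_comp, ← map_mul,
          ← zpow_add_one, hexp, sup_comm]
      simp only [X]
      rw [hPmap, sup_assoc]
    have hXmono : Monotone X := monotone_nat_of_le_succ fun n => by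
      rw [hXsucc]; exact le_sup_left
    have hXfree : ∀ n, FreeAway r (X n) (X (n + 1)) := by
      intro n
      rw [hXsucc]
      refine FreeAway.sup_map (rep_injective ρ _) ?_
      convert hr using 2
      have hXmap : X n = (U ⊔ P.map (ρ x)).map (ρ (x ^ (-((n + 1 : ℕ) : ℤ)))) := by
        rw [Submodule.map_sup, hUmap, ← Submodule.map_comp, ← Module.End.mul_eq_comp, ← map_mul,
          ← zpow_add_one]
        simp only [X]
        congr 5
        push_cast; ring
      rw [hXmap, Submodule.comap_map_eq_of_injective (rep_injective ρ _)]
    have hneg : FreeAway r (U ⊔ P) (⨆ n, X n) := by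
      have := FreeAway.iSup hXmono hXfree
      have h0 : P.map (ρ (x ^ (-((0 : ℕ) : ℤ)))) = P := by
        simp only [Nat.cast_zero, neg_zero, zpow_zero, map_one]
        exact Submodule.map_id P
      simpa only [X, h0] using this
    have htop : ⨆ n, X n = orbitSpan ρ (K ⊔ Subgroup.zpowers x) F := by
      have hV : IsInvariantUnder ρ (K ⊔ Subgroup.zpowers x)
        (orbitSpan ρ (K ⊔ Subgroup.zpowers x) F) := .orbitSpan F
      have hNV : N ≤ orbitSpan ρ (K ⊔ Subgroup.zpowers x) F :=
        orbitSpan_le (hV.mono le_sup_left) (subset_orbitSpan F)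
      have hstage : ∀ n, stage (ρ x) N n ≤ orbitSpan ρ (K ⊔ Subgroup.zpowers x) F := by
        intro n
        induction n with
        | zero => exact bot_le
        | succ n ih =>
          refine sup_le ih (Submodule.map_le_iff_le_comap.2 fun v hv => ?_)
          rw [Submodule.mem_comap, ← map_pow]
          exact hV _ (Subgroup.pow_mem _ hxmem n) v (hNV hv)
      refine le_antisymm (iSup_le fun n => sup_le hU ?_) fun v hv => ?_
      · exact Submodule.map_le_iff_le_comap.2 fun v hv =>
          hV _ (Subgroup.zpow_mem _ hxmem _) v (iSup_le hstage hv)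
      · obtain ⟨k, n, hkn⟩ := exists_mem_stage hx hv
        refine le_iSup X k (Submodule.mem_sup_right ⟨_, le_iSup (stage (ρ x) N) n hkn, ?_⟩)
        rw [zpow_neg, zpow_natCast, rep_inv_apply_self]
    refine ⟨t * r, mul_ne_zero ht0 hr0, ?_⟩
    rw [← htop]
    refine (hpos.mono (dvd_mul_right t r)).trans le_sup_left ?_ (hneg.mono (dvd_mul_left r t))
    refine le_trans (le_of_eq ?_) (le_iSup X 0)
    simp only [X, Nat.cast_zero, neg_zero, zpow_zero, map_one]
    rw [show P.map (1 : Module.End J M) = P from Submodule.map_id P]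

end Invariant

section PolycyclicNilpotent

open scoped commutatorElement

variable {H : Type*} [Group H]

lemma exists_mul_zpow_eq {K : Subgroup H} {x k : H} (hx : x ∈ Subgroup.normalizer (K : Set H))
    (hk : k ∈ K) (j : ℤ) : ∃ k' ∈ K, (x * k) ^ j = x ^ j * k' := by
  induction j using Int.induction_on with
  | zero => exact ⟨1, K.one_mem, by simp⟩
  | succ j ih =>
    obtain ⟨k', hk', h⟩ := ih
    refine ⟨_, K.mul_mem (conj_zpow_mem hx 1 hk') hk, ?_⟩
    rw [zpow_add_one, h, zpow_add_one]
    group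
  | pred j ih =>
    obtain ⟨k', hk', h⟩ := ih
    refine ⟨_, conj_zpow_mem hx (-1) (K.mul_mem hk' (K.inv_mem hk)), ?_⟩
    rw [zpow_sub_one, h, zpow_sub_one]
    group

lemma IsPolycyclic.of_le {K : Subgroup H} (hK : IsPolycyclic K) :
    ∀ L : Subgroup H, L ≤ K → IsPolycyclic L := by
  induction hK with
  | bot => intro L hL; rw [le_bot_iff.1 hL]; exact .bot
  | sup_zpowers K x hK hx ih =>
    intro L hL
    let I : AddSubgroup ℤ :=
      { carrier := {i | ∃ k ∈ K, x ^ i * k ∈ L}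
        zero_mem' := ⟨1, K.one_mem, by simp⟩
        add_mem' := by
          rintro i j ⟨k, hk, hik⟩ ⟨l, hl, hjl⟩
          refine ⟨_, K.mul_mem (conj_zpow_mem hx j hk) hl, ?_⟩
          convert L.mul_mem hik hjl using 1
          group
        neg_mem' := by
          rintro i ⟨k, hk, hik⟩
          refine ⟨_, conj_zpow_mem hx (-i) (K.inv_mem hk), ?_⟩
          convert L.inv_mem hik using 1
          group }
    obtain ⟨n, hn⟩ := Int.subgroup_cyclic I
    rw [← AddSubgroup.zmultiples_eq_closure] at hn
    obtain ⟨k, hk, hl⟩ : n ∈ I := hn ▸ AddSubgroup.mem_zmultiples n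
    have hxn := Subgroup.zpow_mem _ hx n
    have hkn : k ∈ Subgroup.normalizer (K : Set H) := Subgroup.le_normalizer hk
    have hlnorm : x ^ n * k ∈ Subgroup.normalizer ((L ⊓ K : Subgroup H) : Set H) := by
      rw [Subgroup.mem_normalizer_iff]
      intro h
      have h1 := Subgroup.mem_normalizer_iff.1 (Subgroup.mul_mem _ hxn hkn) h
      have h2 := Subgroup.mem_normalizer_iff.1 (Subgroup.le_normalizer hl) h
      rw [Subgroup.mem_inf, Subgroup.mem_inf, h1, h2]
    have heq : L = (L ⊓ K) ⊔ Subgroup.zpowers (x ^ n * k) := by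
      refine le_antisymm (fun g hg => ?_) (sup_le inf_le_left (Subgroup.zpowers_le.2 hl))
      obtain ⟨i, k', hk', rfl⟩ := (mem_sup_zpowers_iff hx).1 (hL hg)
      have hi : i ∈ I := ⟨k', hk', hg⟩
      rw [hn] at hi
      obtain ⟨j, rfl⟩ := AddSubgroup.mem_zmultiples_iff.1 hi
      obtain ⟨l, hlK, hlj⟩ := exists_mul_zpow_eq hxn hk j
      rw [mem_sup_zpowers_iff hlnorm]
      refine ⟨j, l⁻¹ * k', ⟨?_, K.mul_mem (K.inv_mem hlK) hk'⟩, ?_⟩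
      · have := L.mul_mem (L.inv_mem (L.zpow_mem hl j)) hg
        rw [hlj, ← zpow_mul, smul_eq_mul, mul_comm j n] at this
        have e : (x ^ (n * j) * l)⁻¹ * (x ^ (n * j) * k') = l⁻¹ * k' := by group
        rwa [e] at this
      · rw [hlj, ← zpow_mul, smul_eq_mul, mul_comm j n]
        group
    rw [heq]
    exact .sup_zpowers _ _ (ih _ inf_le_right) hlnorm

lemma IsPolycyclic.finite_of_torsion {K : Subgroup H} (hK : IsPolycyclic K)
    (ht : ∀ g ∈ K, IsOfFinOrder g) : (K : Set H).Finite := by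
  induction hK with
  | bot => simp
  | sup_zpowers K x hK hx ih =>
    have h1 := ih fun g hg => ht g (Subgroup.mem_sup_left hg)
    have h2 : (Subgroup.zpowers x : Set H).Finite :=
      finite_zpowers.2 (ht x (Subgroup.mem_sup_right (Subgroup.mem_zpowers x)))
    refine (h2.image2 (fun a b => a * b) h1).subset fun g hg => ?_
    obtain ⟨i, k, hk, rfl⟩ := (mem_sup_zpowers_iff hx).1 hg
    exact ⟨_, Subgroup.zpow_mem_zpowers x i, k, hk, rfl⟩

lemma commutator_normalClosure_le {S F : Set H} (hS : Subgroup.closure S = ⊤) :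
    ⁅Subgroup.normalClosure F, (⊤ : Subgroup H)⁆ ≤
      Subgroup.normalClosure (Set.image2 (fun f s => ⁅f, s⁆) F S) := by
  set N := Subgroup.normalClosure (Set.image2 (fun f s => ⁅f, s⁆) F S) with hN
  have hcent : Subgroup.normalClosure F ≤
      (Subgroup.center (H ⧸ N)).comap (QuotientGroup.mk' N) := by
    refine Subgroup.normalClosure_le_normal fun f hf => ?_
    have hle : (⊤ : Subgroup H) ≤
        (Subgroup.centralizer {QuotientGroup.mk' N f}).comap (QuotientGroup.mk' N) := by
      rw [← hS, Subgroup.closure_le]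
      intro s hs
      have : ⁅f, s⁆ ∈ N := Subgroup.subset_normalClosure ⟨f, hf, s, hs, rfl⟩
      rw [SetLike.mem_coe, Subgroup.mem_comap, Subgroup.mem_centralizer_singleton_iff]
      rw [← QuotientGroup.eq_one_iff, ← QuotientGroup.mk'_apply, map_commutatorElement,
        commutatorElement_eq_one_iff_mul_comm] at this
      exact this.symm
    rw [SetLike.mem_coe, Subgroup.mem_comap, Subgroup.mem_center_iff]
    intro g
    obtain ⟨g, rfl⟩ := QuotientGroup.mk'_surjective N g
    exact Subgroup.mem_centralizer_singleton_iff.1 (hle (Subgroup.mem_top g))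
  rw [Subgroup.commutator_le]
  intro a ha b _
  rw [← QuotientGroup.eq_one_iff, ← QuotientGroup.mk'_apply, map_commutatorElement,
    commutatorElement_eq_one_iff_mul_comm]
  exact (Subgroup.mem_center_iff.1 (hcent ha) _).symm

lemma exists_finite_normalClosure_eq_lowerCentralSeries [hH : Group.FG H] (n : ℕ) :
    ∃ F : Set H, F.Finite ∧
      Subgroup.normalClosure F = (⊤ : Subgroup H).lowerCentralSeries n := by
  obtain ⟨S, hS, hfin⟩ := Group.fg_iff.1 hH
  induction n with
  | zero =>
    refine ⟨S, hfin, top_le_iff.1 ?_⟩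
    rw [← hS]
    exact Subgroup.closure_le_normalClosure
  | succ n ih =>
    obtain ⟨F, hF, h⟩ := ih
    refine ⟨_, hF.image2 (fun f s => ⁅f, s⁆) hfin,
      le_antisymm (Subgroup.normalClosure_le_normal ?_) ?_⟩
    · rintro _ ⟨f, hf, s, _, rfl⟩
      rw [SetLike.mem_coe, Subgroup.lowerCentralSeries_succ]
      exact Subgroup.commutator_mem_commutator (h ▸ Subgroup.subset_normalClosure hf)
        (Subgroup.mem_top s)
    · rw [Subgroup.lowerCentralSeries_succ, ← h]
      exact commutator_normalClosure_le hS

lemma normal_of_lowerCentralSeries_le {X : Subgroup H} {n : ℕ}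
    (h1 : (⊤ : Subgroup H).lowerCentralSeries (n + 1) ≤ X)
    (h2 : X ≤ (⊤ : Subgroup H).lowerCentralSeries n) : X.Normal := by
  refine ⟨fun a ha g => ?_⟩
  have : ⁅a, g⁆ ∈ X := h1 (by
    rw [Subgroup.lowerCentralSeries_succ]
    exact Subgroup.commutator_mem_commutator (h2 ha) (Subgroup.mem_top g))
  convert X.mul_mem (X.inv_mem this) ha using 1
  rw [commutatorElement_def]
  group

lemma isPolycyclic_top [Group.FG H] [Group.IsNilpotent H] :
    IsPolycyclic (⊤ : Subgroup H) := by
  obtain ⟨c, hc⟩ := Subgroup.nilpotent_iff_lowerCentralSeries.1 ‹Group.IsNilpotent H›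
  have key : ∀ n, n ≤ c → IsPolycyclic ((⊤ : Subgroup H).lowerCentralSeries (c - n)) := by
    intro n
    induction n with
    | zero => intro _; rw [Nat.sub_zero, hc]; exact .bot
    | succ n ih =>
      intro hn
      have ih := ih (by omega)
      set m := c - (n + 1)
      have hm : c - n = m + 1 := by omega
      rw [hm] at ih
      obtain ⟨F, hF, hFm⟩ := exists_finite_normalClosure_eq_lowerCentralSeries (H := H) m
      have hmle : (⊤ : Subgroup H).lowerCentralSeries (m + 1) ≤
          (⊤ : Subgroup H).lowerCentralSeries m := Subgroup.lowerCentralSeries_antitone _ m.le_succ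
      have hFsub : F ⊆ (⊤ : Subgroup H).lowerCentralSeries m :=
        hFm ▸ Subgroup.subset_normalClosure
      have hX : ∀ F' : Set H, F' ⊆ (⊤ : Subgroup H).lowerCentralSeries m →
          ((⊤ : Subgroup H).lowerCentralSeries (m + 1) ⊔ Subgroup.closure F').Normal :=
        fun F' hF' => normal_of_lowerCentralSeries_le le_sup_left
          (sup_le hmle ((Subgroup.closure_le _).2 hF'))
      have hpoly : ∀ F' : Set H, F'.Finite → F' ⊆ (⊤ : Subgroup H).lowerCentralSeries m →
          IsPolycyclic ((⊤ : Subgroup H).lowerCentralSeries (m + 1) ⊔ Subgroup.closure F') := by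
        intro F' hF'
        induction F', hF' using Set.Finite.induction_on with
        | empty => intro _; rwa [Subgroup.closure_empty, sup_bot_eq]
        | @insert f F' _ _ ih' =>
          intro hsub
          have hn := hX F' ((Set.subset_insert f F').trans hsub)
          rw [Set.insert_eq, Set.union_comm, Subgroup.closure_union, ← sup_assoc,
            ← Subgroup.zpowers_eq_closure]
          refine .sup_zpowers _ f (ih' ((Set.subset_insert f F').trans hsub)) ?_
          rw [Subgroup.normalizer_eq_top_iff.2 hn]
          exact Subgroup.mem_top f
      have heq : (⊤ : Subgroup H).lowerCentralSeries m =
          (⊤ : Subgroup H).lowerCentralSeries (m + 1) ⊔ Subgroup.closure F := by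
        refine le_antisymm ?_ (sup_le hmle ((Subgroup.closure_le _).2 hFsub))
        have := hX F hFsub
        rw [← hFm]
        exact Subgroup.normalClosure_le_normal
          (Subgroup.subset_closure.trans (SetLike.coe_subset_coe.2 le_sup_right))
      rw [heq]
      exact hpoly F hF hFsub
  simpa using key c le_rfl

lemma commutatorElement_pow_left {G : Type*} [Group G] {a h : G}
    (hc : ⁅a, h⁆ ∈ Subgroup.center G) (m : ℕ) : ⁅a ^ m, h⁆ = ⁅a, h⁆ ^ m := by
  induction m with
  | zero => simp
  | succ m ih =>
    have hcomm := Subgroup.mem_center_iff.1 hc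
    have : ⁅a ^ (m + 1), h⁆ = a * ⁅a ^ m, h⁆ * a⁻¹ * ⁅a, h⁆ := by
      simp only [commutatorElement_def]
      group
    rw [this, ih, pow_succ]
    have hcm := Subgroup.mem_center_iff.1 (Subgroup.pow_mem _ hc m) a
    rw [hcm]
    group

/-- In a finitely generated nilpotent group, a subgroup meeting the centre in torsion elements
is finite. -/
lemma finite_of_inf_center_torsion [Group.FG H] [Group.IsNilpotent H] (N : Subgroup H) [N.Normal]
    (ht : ∀ a ∈ N, a ∈ Subgroup.center H → IsOfFinOrder a) : (N : Set H).Finite := by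
  have hfin : ((N ⊓ Subgroup.center H : Subgroup H) : Set H).Finite :=
    (isPolycyclic_top.of_le _ le_top).finite_of_torsion fun g hg => ht g hg.1 hg.2
  obtain ⟨e, he0, he⟩ : ∃ e : ℕ, 0 < e ∧ ∀ a ∈ N, a ∈ Subgroup.center H → a ^ e = 1 := by
    have : Finite (N ⊓ Subgroup.center H : Subgroup H) := hfin
    refine ⟨Nat.card (N ⊓ Subgroup.center H : Subgroup H), Nat.card_pos, fun a ha hc => ?_⟩
    have := pow_card_eq_one' (x := (⟨a, ha, hc⟩ : (N ⊓ Subgroup.center H : Subgroup H)))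
    exact congrArg Subtype.val this
  have step : ∀ i, ∀ a ∈ N, a ∈ Subgroup.upperCentralSeries H (i + 1) →
      a ^ e ∈ Subgroup.upperCentralSeries H i := by
    intro i
    induction i with
    | zero =>
      intro a ha hc
      rw [Subgroup.upperCentralSeries_one] at hc
      rw [he a ha hc]
      exact Subgroup.one_mem _
    | succ i ih =>
      intro a ha hc
      rw [Subgroup.mem_upperCentralSeries_succ_iff] at hc ⊢
      intro h
      have hN : ⁅a, h⁆ ∈ N := by
        rw [commutatorElement_def, mul_assoc, mul_assoc]
        refine N.mul_mem ha ?_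
        rw [← mul_assoc]
        exact Subgroup.Normal.conj_mem inferInstance _ (N.inv_mem ha) h
      have h1 := ih _ hN (hc h)
      set Z := Subgroup.upperCentralSeries H i
      have hcen : ⁅QuotientGroup.mk' Z a, QuotientGroup.mk' Z h⁆ ∈ Subgroup.center (H ⧸ Z) := by
        rw [Subgroup.mem_center_iff]
        intro y
        obtain ⟨y, rfl⟩ := QuotientGroup.mk'_surjective Z y
        have := Subgroup.mem_upperCentralSeries_succ_iff.1 (hc h) y
        rw [← QuotientGroup.eq_one_iff, ← QuotientGroup.mk'_apply, map_commutatorElement,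
          commutatorElement_eq_one_iff_mul_comm, map_commutatorElement] at this
        exact this.symm
      rw [← QuotientGroup.eq_one_iff, ← QuotientGroup.mk'_apply, map_commutatorElement, map_pow,
        commutatorElement_pow_left hcen, ← map_commutatorElement, ← map_pow,
        QuotientGroup.mk'_apply, QuotientGroup.eq_one_iff]
      exact h1
  have tors : ∀ i, ∀ a ∈ N, a ∈ Subgroup.upperCentralSeries H i → IsOfFinOrder a := by
    intro i
    induction i with
    | zero =>
      intro a _ hc
      rw [Subgroup.upperCentralSeries_zero, Subgroup.mem_bot] at hc
      rw [hc]
      exact IsOfFinOrder.one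
    | succ i ih =>
      intro a ha hc
      exact (ih _ (N.pow_mem ha e) (step i a ha hc)).of_pow he0.ne'
  obtain ⟨n, hn⟩ := Group.IsNilpotent.nilpotent H
  exact (isPolycyclic_top.of_le N le_top).finite_of_torsion fun g hg =>
    tors n g hg (hn ▸ Subgroup.mem_top g)

end PolycyclicNilpotent

section FinitelyGeneratedRings

lemma isJacobsonRing_int : IsJacobsonRing ℤ := by
  rw [isJacobsonRing_iff_prime_eq]
  intro P hP
  by_cases h : P = ⊥
  · subst h
    refine le_antisymm (fun n hn => ?_) Ideal.le_jacobson
    have := Int.isUnit_iff.1 (Ideal.mem_jacobson_bot.1 hn n)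
    rw [Ideal.mem_bot]
    rcases this with h | h <;> nlinarith [mul_self_nonneg n]
  · have := hP.isMaximal h
    exact Ideal.jacobson_eq_self_of_isMaximal

lemma finite_of_finiteType_int (E : Type*) [CommRing E] (hE : IsField E)
    [Algebra.FiniteType ℤ E] : Finite E := by
  have := isJacobsonRing_int
  let _ := hE.toField
  have hfin : Module.Finite ℤ E := finite_of_finite_type_of_isJacobsonRing ℤ E
  have htor : ∃ n : ℤ, n ≠ 0 ∧ (n : E) = 0 := by
    by_contra! h
    have hinj : Function.Injective (algebraMap ℤ E) := by
      rw [injective_iff_map_eq_zero]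
      intro n hn
      by_contra h0
      exact h n h0 (by simpa using hn)
    have : Algebra.IsIntegral ℤ E := inferInstance
    exact Int.not_isField (isField_of_isIntegral_of_isField hinj hE)
  obtain ⟨n, hn, hn0⟩ := htor
  refine Module.finite_of_fg_torsion E fun {x} => ⟨⟨n, mem_nonZeroDivisors_of_ne_zero hn⟩, ?_⟩
  change n • x = 0
  rw [zsmul_eq_mul, hn0, zero_mul]

lemma exists_isMaximal_notMem {E : Type*} [CommRing E] [IsDomain E] [Algebra.FiniteType ℤ E]
    {s : E} (hs : s ≠ 0) : ∃ m : Ideal E, m.IsMaximal ∧ s ∉ m := by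
  have := isJacobsonRing_int
  have hJ : IsJacobsonRing E := isJacobsonRing_of_finiteType (A := ℤ)
  by_contra! h
  have h0 := isJacobsonRing_iff_prime_eq.1 hJ ⊥ Ideal.isPrime_bot
  apply hs
  rw [← Ideal.mem_bot, ← h0, Ideal.jacobson, Ideal.mem_sInf]
  exact fun {I} hI => h I hI.2

end FinitelyGeneratedRings

section Determinant

variable {E A : Type*} [CommRing E] [AddCommGroup A] [Module E A]

lemma IndepMod.linearIndepOn {B : Set A} (hB : IndepMod (⊥ : Submodule E A) B) :
    LinearIndepOn E id B := by
  rw [linearIndepOn_iff]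
  intro l hl h0
  exact hB l ((Finsupp.mem_supported E l).1 hl) ((Submodule.mem_bot E).2 h0)

lemma exists_pow_smul_mem_smul_span {s : E} {B : Set A} (m : Ideal E)
    (hs : ∀ v : A, ∃ k : ℕ, s ^ k • v ∈ Submodule.span E B) {x : A}
    (hx : x ∈ m • (⊤ : Submodule E A)) :
    ∃ k : ℕ, s ^ k • x ∈ m • Submodule.span E B := by
  induction hx using Submodule.smul_induction_on' with
  | smul r hr n _ =>
    obtain ⟨k, hk⟩ := hs n
    refine ⟨k, ?_⟩
    rw [smul_comm]
    exact Submodule.smul_mem_smul hr hk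
  | add x _ y _ hx hy =>
    obtain ⟨k, hk⟩ := hx
    obtain ⟨l, hl⟩ := hy
    refine ⟨k + l, ?_⟩
    rw [smul_add]
    refine Submodule.add_mem _ ?_ ?_
    · rw [add_comm, pow_add, mul_smul]
      exact Submodule.smul_mem _ _ hk
    · rw [pow_add, mul_smul]
      exact Submodule.smul_mem _ _ hl

/-- A generic basis is finite as soon as one fibre over a maximal ideal in the free locus is
finite dimensional. -/
lemma finite_of_finite_fibre {s : E} {B : Set A} (hB : LinearIndepOn E id B)
    (hs : ∀ v : A, ∃ k : ℕ, s ^ k • v ∈ Submodule.span E B) (m : Ideal E) [hm : m.IsMaximal]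
    (hsm : s ∉ m) {G : Set A} (hG : G.Finite)
    (hGm : m • (⊤ : Submodule E A) ⊔ Submodule.span E G = ⊤) : B.Finite := by
  let _ := Ideal.Quotient.field m
  let Q := A ⧸ (m • (⊤ : Submodule E A))
  have hfin : Module.Finite E Q := by
    refine ⟨?_⟩
    have : (⊤ : Submodule E Q) = (Submodule.span E G).map (Submodule.mkQ _) := by
      rw [← (Submodule.map_mkQ_eq_top (m • (⊤ : Submodule E A)) (Submodule.span E G)).2 hGm]
    rw [this]
    exact (Submodule.fg_span hG).map _
  have hfin' : Module.Finite (E ⧸ m) Q := Module.Finite.of_restrictScalars_finite E (E ⧸ m) Q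
  have hli : LinearIndependent (E ⧸ m) fun b : B => (Submodule.Quotient.mk (b : A) : Q) := by
    rw [linearIndependent_iff']
    intro t g hg i hi
    choose c hc using fun b => Ideal.Quotient.mk_surjective (I := m) (g b)
    have h1 : (∑ b ∈ t, c b • (b : A)) ∈ m • (⊤ : Submodule E A) := by
      rw [← Submodule.Quotient.mk_eq_zero, ← Submodule.mkQ_apply, map_sum, ← hg]
      refine Finset.sum_congr rfl fun b _ => ?_
      rw [map_smul, ← hc b]
      rfl
    obtain ⟨k, hk⟩ := exists_pow_smul_mem_smul_span m hs h1
    have hrange : Submodule.span E B = Submodule.span E (Set.range (Subtype.val : B → A)) := by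
      rw [Subtype.range_coe]
    rw [hrange, Submodule.mem_ideal_smul_span_iff_exists_sum] at hk
    obtain ⟨d, hd, hde⟩ := hk
    have hB' : LinearIndependent E (Subtype.val : B → A) := hB
    rw [Finset.smul_sum] at hde
    have h2 : Finsupp.linearCombination E (Subtype.val : B → A) d =
        Finsupp.linearCombination E (Subtype.val : B → A)
          (∑ b ∈ t, Finsupp.single b (s ^ k * c b)) := by
      rw [map_sum, Finsupp.linearCombination_apply, hde]
      refine Finset.sum_congr rfl fun b _ => ?_
      rw [Finsupp.linearCombination_single, mul_smul]
    have h3 := DFunLike.congr_fun (hB' h2) i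
    have h4 : s ^ k * c i ∈ m := by
      classical
      rw [Finsupp.finsetSum_apply, Finset.sum_eq_single i] at h3
      · rw [Finsupp.single_eq_same] at h3
        exact h3 ▸ hd i
      · intro b _ hb
        rw [Finsupp.single_apply, if_neg hb]
      · exact fun h => absurd hi h
    rw [← hc i, Ideal.Quotient.eq_zero_iff_mem]
    exact (hm.isPrime.mem_or_mem h4).resolve_left fun h => hsm (hm.isPrime.mem_of_pow_mem k h)
  exact hli.finite

open TensorProduct in
lemma exists_pow_eq_one_of_generic {H : Type*} [Group H] [IsDomain E] [Nontrivial A]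
    (htf : ∀ (e : E) (a : A), e • a = 0 → e = 0 ∨ a = 0) {s : E} (hs0 : s ≠ 0) {B : Set A}
    (hBfin : B.Finite) (hs : ∀ v : A, ∃ k : ℕ, s ^ k • v ∈ Submodule.span E B)
    (ρ : Representation E H A) {z : H} (hz : z ∈ commutator H) {e : E}
    (he : ∀ a, ρ z a = e • a) : ∃ d : ℕ, 0 < d ∧ e ^ d = 1 := by
  let L := FractionRing E
  let ι : A →ₗ[E] L ⊗[E] A := TensorProduct.mk E L A 1
  have hloc : IsLocalizedModule (nonZeroDivisors E) ι :=
    (isLocalizedModule_iff_isBaseChange _ L ι).2 (TensorProduct.isBaseChange E A L)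
  have hfin : Module.Finite L (L ⊗[E] A) := by
    refine ⟨⟨(hBfin.image ι).toFinset, ?_⟩⟩
    rw [Set.Finite.coe_toFinset, eq_top_iff]
    rintro x -
    induction x using TensorProduct.induction_on with
    | zero => exact Submodule.zero_mem _
    | add x y hx hy => exact Submodule.add_mem _ hx hy
    | tmul l a =>
      obtain ⟨k, hk⟩ := hs a
      have h1 : ι (s ^ k • a) ∈ Submodule.span L (ι '' B) := by
        have h2 : Submodule.span E B ≤
            ((Submodule.span L (ι '' B)).restrictScalars E).comap ι :=
          Submodule.span_le.2 fun b hb => Submodule.subset_span ⟨b, hb, rfl⟩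
        exact h2 hk
      have hsk : algebraMap E L (s ^ k) ≠ 0 := by
        rw [Ne, IsFractionRing.to_map_eq_zero_iff]
        exact pow_ne_zero k hs0
      have h3 : l ⊗ₜ[E] a = (l * (algebraMap E L (s ^ k))⁻¹) • ι (s ^ k • a) := by
        rw [map_smul, ← algebraMap_smul L (s ^ k), smul_smul, mul_assoc, inv_mul_cancel₀ hsk,
          mul_one]
        simp [ι, TensorProduct.smul_tmul']
      rw [h3]
      exact Submodule.smul_mem _ _ h1
  have hnt : Nontrivial (L ⊗[E] A) := by
    obtain ⟨a, ha⟩ := exists_ne (0 : A)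
    refine ⟨ι a, 0, fun h => ?_⟩
    obtain ⟨c, hc⟩ := (IsLocalizedModule.eq_zero_iff (nonZeroDivisors E) ι).1 h
    rcases htf c a hc with h | h
    · exact nonZeroDivisors.ne_zero c.2 h
    · exact ha h
  refine ⟨Module.finrank L (L ⊗[E] A), Module.finrank_pos, ?_⟩
  let f : H →* L := (LinearMap.det : Module.End L (L ⊗[E] A) →* L).comp
    ((Module.End.baseChangeHom E L A : Module.End E A →* Module.End L (L ⊗[E] A)).comp ρ)
  have h1 : f.toHomUnits z = 1 := Abelianization.commutator_subset_ker f.toHomUnits hz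
  have h2 : f z = 1 := by rw [← MonoidHom.coe_toHomUnits, h1, Units.val_one]
  have h3 : ρ z = e • 1 := LinearMap.ext he
  have h4 : f z = algebraMap E L e ^ Module.finrank L (L ⊗[E] A) := by
    change LinearMap.det (Module.End.baseChangeHom E L A (ρ z)) = _
    rw [h3, map_smul, map_one, ← algebraMap_smul L e, LinearMap.det_smul, map_one, mul_one]
  rw [h2, ← map_pow] at h4
  exact IsFractionRing.injective E L (by rw [← h4, map_one])

end Determinant

section Unipotent

variable {J A H : Type*} [CommRing J] [AddCommGroup A] [Module J A] [Group H]

/-- Over `B`, the `n`-th term of the ascending series of submodules on whose factors the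
subgroup `K` acts trivially. -/
def unipotentLayer (ρ : Representation J H A) (K : Subgroup H) (B : Submodule J A) :
    ℕ → Submodule J A
  | 0 => B
  | n + 1 => ⨅ k : K, (unipotentLayer ρ K B n).comap (ρ k - 1)

/-- Some subgroup of finite index acts unipotently modulo `B`. -/
def VirtuallyUnipotentMod (ρ : Representation J H A) (B : Submodule J A) : Prop :=
  ∃ K : Subgroup H, K.FiniteIndex ∧ ∃ n, unipotentLayer ρ K B n = ⊤

variable {ρ : Representation J H A} {K K' : Subgroup H} {B B' : Submodule J A}

lemma mem_unipotentLayer_succ {n : ℕ} {a : A} :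
    a ∈ unipotentLayer ρ K B (n + 1) ↔ ∀ k ∈ K, ρ k a - a ∈ unipotentLayer ρ K B n := by
  simp [unipotentLayer, Submodule.mem_iInf]

lemma unipotentLayer_mono (h : B ≤ B') (n : ℕ) :
    unipotentLayer ρ K B n ≤ unipotentLayer ρ K B' n := by
  induction n with
  | zero => exact h
  | succ n ih =>
    intro a ha
    rw [mem_unipotentLayer_succ] at ha ⊢
    exact fun k hk => ih (ha k hk)

lemma unipotentLayer_anti (h : K' ≤ K) (n : ℕ) :
    unipotentLayer ρ K B n ≤ unipotentLayer ρ K' B n := by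
  induction n with
  | zero => exact le_rfl
  | succ n ih =>
    intro a ha
    rw [mem_unipotentLayer_succ] at ha ⊢
    exact fun k hk => ih (ha k (h hk))

lemma unipotentLayer_unipotentLayer (m n : ℕ) :
    unipotentLayer ρ K (unipotentLayer ρ K B m) n = unipotentLayer ρ K B (m + n) := by
  induction n with
  | zero => rfl
  | succ n ih =>
    ext a
    rw [← add_assoc, mem_unipotentLayer_succ, mem_unipotentLayer_succ, ih]

lemma IsInvariantUnder.unipotentLayer (hB : IsInvariantUnder ρ K B) (n : ℕ) :
    IsInvariantUnder ρ K (unipotentLayer ρ K B n) := by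
  induction n with
  | zero => exact hB
  | succ n ih =>
    intro k hk a ha
    rw [mem_unipotentLayer_succ] at ha ⊢
    intro l hl
    have := ih k hk _ (ha _ (K.mul_mem (K.mul_mem (K.inv_mem hk) hl) hk))
    rwa [map_sub, ← rep_mul_apply, ← mul_assoc, ← mul_assoc, mul_inv_cancel, one_mul,
      rep_mul_apply] at this

lemma map_mem_unipotentLayer_bot {φ : Module.End J A} (hφ : ∀ h a, φ (ρ h a) = ρ h (φ a))
    (n : ℕ) : ∀ a ∈ unipotentLayer ρ K (LinearMap.ker φ) n, φ a ∈ unipotentLayer ρ K ⊥ n := by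
  induction n with
  | zero => exact fun a ha => (Submodule.mem_bot J).2 ha
  | succ n ih =>
    intro a ha
    rw [mem_unipotentLayer_succ] at ha ⊢
    intro k hk
    rw [← hφ, ← map_sub]
    exact ih _ (ha k hk)

lemma VirtuallyUnipotentMod.bot_of_ker_of_range {φ : Module.End J A}
    (hφ : ∀ h a, φ (ρ h a) = ρ h (φ a)) (h₁ : VirtuallyUnipotentMod ρ (LinearMap.ker φ))
    (h₂ : VirtuallyUnipotentMod ρ (LinearMap.range φ)) : VirtuallyUnipotentMod ρ ⊥ := by
  obtain ⟨K, hK, n, hn⟩ := h₁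
  obtain ⟨K', hK', n', hn'⟩ := h₂
  refine ⟨K ⊓ K', inferInstance, n + n', top_le_iff.1 ?_⟩
  have hr : LinearMap.range φ ≤ unipotentLayer ρ (K ⊓ K') ⊥ n := by
    rintro _ ⟨a, rfl⟩
    refine map_mem_unipotentLayer_bot hφ n a (unipotentLayer_anti inf_le_left n ?_)
    rw [hn]
    trivial
  rw [← unipotentLayer_unipotentLayer, ← hn']
  exact (unipotentLayer_anti inf_le_right n').trans (unipotentLayer_mono hr n')

lemma InvariantACC.exists_finite_orbitSpan_eq {V L : Submodule J A} (h : InvariantACC ρ K V)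
    (hL : IsInvariantUnder ρ K L) (hLV : L ≤ V) :
    ∃ F : Set A, F.Finite ∧ F ⊆ L ∧ orbitSpan ρ K F = L := by
  have : WellFoundedGT {L : Submodule J A // IsInvariantUnder ρ K L ∧ L ≤ V} := h
  let S : Set {L : Submodule J A // IsInvariantUnder ρ K L ∧ L ≤ V} :=
    {X | ∃ F : Set A, F.Finite ∧ F ⊆ L ∧ orbitSpan ρ K F = X.1}
  have hne : S.Nonempty :=
    ⟨⟨orbitSpan ρ K ∅, .orbitSpan ∅, orbitSpan_le (hL.mono le_rfl) (by simp) |>.trans hLV⟩,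
      ∅, Set.finite_empty, by simp, rfl⟩
  obtain ⟨X, ⟨F, hF, hFL, hFX⟩, hmax⟩ := (wellFounded_gt (α :=
    {L : Submodule J A // IsInvariantUnder ρ K L ∧ L ≤ V})).has_min S hne
  refine ⟨F, hF, hFL, le_antisymm (orbitSpan_le hL hFL) fun v hv => ?_⟩
  by_contra hvF
  have hins : insert v F ⊆ (L : Set A) := Set.insert_subset hv hFL
  refine hmax ⟨orbitSpan ρ K (insert v F), .orbitSpan _, (orbitSpan_le hL hins).trans hLV⟩
    ⟨_, hF.insert v, hins, rfl⟩ ?_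
  change X.1 < orbitSpan ρ K (insert v F)
  rw [← hFX]
  refine lt_of_le_of_ne (orbitSpan_le (.orbitSpan _)
    ((Set.subset_insert v F).trans (subset_orbitSpan _))) fun heq => hvF ?_
  rw [heq]
  exact subset_orbitSpan _ (Set.mem_insert v F)

lemma orbitSpan_le_sup_span {F : Set A} {n : ℕ}
    (hF : F ⊆ unipotentLayer ρ K B (n + 1)) :
    orbitSpan ρ K F ≤ unipotentLayer ρ K B n ⊔ Submodule.span J F := by
  refine Submodule.span_le.2 ?_
  rintro _ ⟨k, hk, f, hf, rfl⟩
  have h1 := mem_unipotentLayer_succ.1 (hF hf) k hk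
  rw [← sub_add_cancel (ρ k f) f]
  exact Submodule.add_mem_sup h1 (Submodule.subset_span hf)

lemma InvariantACC.exists_finite_sup_span_eq_top (h : InvariantACC ρ K ⊤)
    (hB : IsInvariantUnder ρ K B) {n : ℕ} (hn : unipotentLayer ρ K B n = ⊤) :
    ∃ G : Set A, G.Finite ∧ B ⊔ Submodule.span J G = ⊤ := by
  have key : ∀ i, ∃ G : Set A, G.Finite ∧ unipotentLayer ρ K B i ≤ B ⊔ Submodule.span J G := by
    intro i
    induction i with
    | zero => exact ⟨∅, Set.finite_empty, le_sup_left⟩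
    | succ i ih =>
      obtain ⟨G, hG, hle⟩ := ih
      obtain ⟨F, hF, hFsub, hFeq⟩ := h.exists_finite_orbitSpan_eq (hB.unipotentLayer (i + 1)) le_top
      refine ⟨G ∪ F, hG.union hF, ?_⟩
      rw [← hFeq, Submodule.span_union, ← sup_assoc]
      exact (orbitSpan_le_sup_span hFsub).trans (sup_le_sup_right hle _)
  obtain ⟨G, hG, hle⟩ := key n
  exact ⟨G, hG, top_le_iff.1 (hn ▸ hle)⟩

lemma exists_finite_orbitSpan_eq_top_of_finiteIndex [hK : K.FiniteIndex] {F : Set A}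
    (hF : F.Finite) (hA : orbitSpan ρ ⊤ F = ⊤) :
    ∃ F' : Set A, F'.Finite ∧ orbitSpan ρ K F' = ⊤ := by
  have : Finite (H ⧸ K) := inferInstance
  refine ⟨Set.image2 (fun (q : H ⧸ K) f => ρ q.out⁻¹ f) Set.univ F, Set.finite_univ.image2 _ hF, ?_⟩
  rw [← top_le_iff, ← hA]
  refine Submodule.span_le.2 ?_
  rintro _ ⟨h, -, f, hf, rfl⟩
  obtain ⟨k, hk⟩ := QuotientGroup.mk_out_eq_mul K h⁻¹
  refine Submodule.subset_span ⟨k, k.2, _, ⟨(h⁻¹ : H), Set.mem_univ _, f, hf, rfl⟩, ?_⟩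
  rw [← rep_mul_apply, hk]
  congr 2
  group

end Unipotent

section FiniteIndexCenter

open scoped IsMulCommutative

variable {H A : Type*} [Group H] [AddCommGroup A] {ρ : Representation ℤ H A}

/-- A representation whose coefficients are extended to a ring of commuting endomorphisms. -/
def extendCoefficients {E : Type*} [CommRing E] [Module E A] (ρ : Representation ℤ H A)
    (hE : ∀ (e : E) (h : H) (a : A), ρ h (e • a) = e • ρ h a) : Representation E H A where
  toFun h := { toFun := ρ h, map_add' := map_add _, map_smul' := fun e a => hE e h a }
  map_one' := by ext a; simp
  map_mul' g h := by ext a; simp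

lemma orbitSpan_extendCoefficients_eq_top {E : Type*} [CommRing E] [Module E A]
    (hE : ∀ (e : E) (h : H) (a : A), ρ h (e • a) = e • ρ h a) {F : Set A}
    (hF : orbitSpan ρ ⊤ F = ⊤) : orbitSpan (extendCoefficients ρ hE) ⊤ F = ⊤ := by
  rw [eq_top_iff]
  rintro a -
  have ha : a ∈ orbitSpan ρ ⊤ F := by rw [hF]; trivial
  have hinv : IsInvariantUnder ρ ⊤
      ((orbitSpan (extendCoefficients ρ hE) ⊤ F).toAddSubgroup.toIntSubmodule) := by
    intro k hk v hv
    exact IsInvariantUnder.orbitSpan (ρ := extendCoefficients ρ hE) F k hk v hv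
  exact orbitSpan_le hinv (subset_orbitSpan (ρ := extendCoefficients ρ hE) F) ha

lemma isOfFinOrder_of_scalar [Group.FG H] [Group.IsNilpotent H] {E : Type*} [CommRing E]
    [IsDomain E] [Algebra.FiniteType ℤ E] [Module E A] [Nontrivial A]
    (htf : ∀ (e : E) (a : A), e • a = 0 → e = 0 ∨ a = 0)
    (hE : ∀ (e : E) (h : H) (a : A), ρ h (e • a) = e • ρ h a) {F : Set A} (hFfin : F.Finite)
    (hF : orbitSpan ρ ⊤ F = ⊤)
    (hB : ∀ B : Submodule ℤ A, IsInvariantUnder ρ ⊤ B → B ≠ ⊥ → VirtuallyUnipotentMod ρ B)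
    {z : H} (hz : z ∈ commutator H) {e : E} (he : ∀ a, ρ z a = e • a) :
    ∃ d : ℕ, 0 < d ∧ e ^ d = 1 := by
  obtain ⟨a₀, ha₀⟩ := exists_ne (0 : A)
  have he0 : e ≠ 0 := by
    rintro rfl
    apply ha₀
    apply rep_injective ρ z
    rw [he, zero_smul, map_zero]
  by_cases hfield : IsField E
  · have := finite_of_finiteType_int E hfield
    obtain ⟨b, hb⟩ := hfield.mul_inv_cancel he0
    obtain ⟨d, hd, hd1⟩ := isOfFinOrder_iff_pow_eq_one.1
      (isOfFinOrder_of_finite (Units.mkOfMulEqOne e b hb))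
    exact ⟨d, hd, by simpa using congrArg Units.val hd1⟩
  have : IsNoetherianRing E := Algebra.FiniteType.isNoetherianRing ℤ E
  have htop := orbitSpan_extendCoefficients_eq_top hE hF
  obtain ⟨s, hs0, B, -, hBind, hBs⟩ := exists_freeAway_orbitSpan (extendCoefficients ρ hE)
    isPolycyclic_top hFfin ⊥ .bot bot_le
  have hBs' : ∀ v : A, ∃ k : ℕ, s ^ k • v ∈ Submodule.span E B := fun v => by
    simpa using hBs v (by rw [htop]; trivial)
  obtain ⟨m, hm, hsm⟩ := exists_isMaximal_notMem hs0
  have hm0 : m ≠ ⊥ := Ring.ne_bot_of_isMaximal_of_not_isField hm hfield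
  obtain ⟨c, hcm, hc0⟩ := Submodule.exists_mem_ne_zero_of_ne_bot hm0
  obtain ⟨N, hN⟩ : ∃ N : Submodule E A, N = m • ⊤ := ⟨_, rfl⟩
  obtain ⟨N', hN'⟩ : ∃ N' : Submodule ℤ A, ∀ a, a ∈ N' ↔ a ∈ N :=
    ⟨N.toAddSubgroup.toIntSubmodule, fun a => Iff.rfl⟩
  have hNne : N' ≠ ⊥ := by
    intro h
    have hmem : c • a₀ ∈ N := hN ▸ Submodule.smul_mem_smul hcm (Submodule.mem_top (x := a₀))
    rw [← hN', h, Submodule.mem_bot] at hmem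
    rcases htf c a₀ hmem with h | h
    · exact hc0 h
    · exact ha₀ h
  have hNinv : ∀ K : Subgroup H, IsInvariantUnder ρ K N' := by
    intro K k _ v hv
    rw [hN', hN] at hv ⊢
    induction hv using Submodule.smul_induction_on' with
    | smul r hr n _ =>
      rw [hE]
      exact Submodule.smul_mem_smul hr trivial
    | add x _ y _ hx hy =>
      rw [map_add]
      exact Submodule.add_mem _ hx hy
  obtain ⟨K, hK, n, hn⟩ := hB _ (hNinv ⊤) hNne
  obtain ⟨F', hF'fin, hF'⟩ := exists_finite_orbitSpan_eq_top_of_finiteIndex (K := K) hFfin hF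
  have hACC := invariantACC_orbitSpan ρ (isPolycyclic_top.of_le K le_top) hF'fin
  rw [hF'] at hACC
  obtain ⟨G, hGfin, hG⟩ := hACC.exists_finite_sup_span_eq_top (hNinv K) hn
  have hGE : N ⊔ Submodule.span E G = ⊤ := by
    rw [eq_top_iff]
    rintro a -
    have ha : a ∈ N' ⊔ Submodule.span ℤ G := by rw [hG]; trivial
    have hle : N' ⊔ Submodule.span ℤ G ≤
        (N ⊔ Submodule.span E G).toAddSubgroup.toIntSubmodule := by
      refine sup_le (fun x hx => ?_) (Submodule.span_le.2 fun x hx => ?_)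
      · exact Submodule.mem_sup_left (S := N) ((hN' x).1 hx)
      · exact Submodule.mem_sup_right (S := N) (Submodule.subset_span hx)
    exact hle ha
  have hBfin := finite_of_finite_fibre hBind.linearIndepOn hBs' m hsm hGfin (hN ▸ hGE)
  exact exists_pow_eq_one_of_generic htf hs0 hBfin hBs' (extendCoefficients ρ hE) hz he

/-- A finitely generated nilpotent group acting faithfully on a finitely generated module which is
not virtually unipotent, although all its proper quotients are, is virtually abelian. -/
theorem finiteIndex_center_of_minimal [Group.FG H] [Group.IsNilpotent H]
    (hρ : Function.Injective ρ) {F : Set A} (hFfin : F.Finite) (hF : orbitSpan ρ ⊤ F = ⊤)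
    (hB : ∀ B : Submodule ℤ A, IsInvariantUnder ρ ⊤ B → B ≠ ⊥ → VirtuallyUnipotentMod ρ B)
    (hbot : ¬ VirtuallyUnipotentMod ρ ⊥) : (Subgroup.center H).FiniteIndex := by
  have hnt : Nontrivial A := by
    by_contra h
    rw [not_nontrivial_iff_subsingleton] at h
    exact hbot ⟨⊤, inferInstance, 0, Subsingleton.elim _ _⟩
  have hinj : ∀ φ : Module.End ℤ A, (∀ h a, φ (ρ h a) = ρ h (φ a)) → φ ≠ 0 →
      LinearMap.ker φ = ⊥ := by
    intro φ hφ hφ0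
    by_contra hker
    refine hbot (.bot_of_ker_of_range hφ (hB _ ?_ hker) (hB _ ?_ ?_))
    · intro k _ v hv
      rw [LinearMap.mem_ker] at hv ⊢
      rw [hφ, hv, map_zero]
    · rintro k _ _ ⟨v, rfl⟩
      exact ⟨ρ k v, hφ k v⟩
    · rwa [Ne, LinearMap.range_eq_bot]
  have htors : ∀ z ∈ commutator H, z ∈ Subgroup.center H → IsOfFinOrder z := by
    intro z hz hzc
    let E := Algebra.adjoin ℤ {ρ z}
    have hcomm : ∀ φ ∈ E, ∀ h a, φ (ρ h a) = ρ h (φ a) := by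
      intro φ hφ h a
      have hle : E ≤ Subalgebra.centralizer ℤ {ρ h} := by
        refine Algebra.adjoin_le ?_
        rintro _ rfl
        rw [SetLike.mem_coe, Subalgebra.mem_centralizer_iff]
        rintro _ rfl
        rw [← map_mul, ← map_mul, Subgroup.mem_center_iff.1 hzc h]
      have := Subalgebra.mem_centralizer_iff ℤ |>.1 (hle hφ) (ρ h) rfl
      exact (LinearMap.congr_fun this a).symm
    have htf : ∀ (e : E) (a : A), e • a = 0 → e = 0 ∨ a = 0 := by
      intro e a h
      by_cases h0 : (e : Module.End ℤ A) = 0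
      · exact Or.inl (Subtype.ext h0)
      · right
        rw [← Submodule.mem_bot ℤ, ← hinj e (hcomm e e.2) h0]
        exact h
    have hdom : IsDomain E := by
      have : Nontrivial E := inferInstance
      have : NoZeroDivisors E := by
        refine ⟨fun {x y} hxy => ?_⟩
        by_contra! h
        apply h.2
        refine Subtype.ext (LinearMap.ext fun a => ?_)
        have : x • (y • a) = 0 := by rw [smul_smul, hxy, zero_smul]
        exact (htf x _ this).resolve_left h.1
      exact NoZeroDivisors.to_isDomain E
    have hft : Algebra.FiniteType ℤ E :=
      (Subalgebra.fg_iff_finiteType _).1 ⟨{ρ z}, by simp [E]⟩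
    obtain ⟨d, hd, hd1⟩ := isOfFinOrder_of_scalar (E := E) htf
      (fun e h a => (hcomm e e.2 h a).symm) hFfin hF hB hz
      (e := ⟨ρ z, Algebra.subset_adjoin rfl⟩) (fun a => rfl)
    refine isOfFinOrder_iff_pow_eq_one.2 ⟨d, hd, hρ ?_⟩
    rw [map_pow, map_one]
    exact congrArg Subtype.val hd1
  have hfin : (commutator H : Set H).Finite := finite_of_inf_center_torsion _ htors
  have : Finite (commutatorSet H) := hfin.subset (by
    rw [commutator_eq_closure]
    exact Subgroup.subset_closure)
  infer_instance

end FiniteIndexCenter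

section VirtuallyNilpotentMod

variable {G' : Type*} [Group G']

variable {G : Type*} [Group G]

/-- Some subgroup of finite index has a term of its lower central series inside `N`. -/
def VirtuallyNilpotentMod (N : Subgroup G) : Prop :=
  ∃ K : Subgroup G, K.FiniteIndex ∧ ∃ n, K.lowerCentralSeries n ≤ N

/-- All metabelian sections `K / N` of `G` with `K` of finite index are virtually nilpotent. -/
def MetabelianSectionsVirtuallyNilpotent (G : Type*) [Group G] : Prop :=
  ∀ K : Subgroup G, K.FiniteIndex → ∀ N : Subgroup G, K ≤ Subgroup.normalizer (N : Set G) →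
    ⁅⁅K, K⁆, ⁅K, K⁆⁆ ≤ N → VirtuallyNilpotentMod N

lemma finiteIndex_comap (f : G →* G') (K : Subgroup G') [hK : K.FiniteIndex] :
    (K.comap f).FiniteIndex := by
  refine ⟨?_⟩
  rw [Subgroup.index_comap]
  exact fun h => hK.index_ne_zero (Subgroup.index_eq_zero_of_relIndex_eq_zero h)

lemma finiteIndex_map (f : G →* G') (hf : f.range.FiniteIndex) (K : Subgroup G)
    [hK : K.FiniteIndex] : (K.map f).FiniteIndex := by
  refine ⟨?_⟩
  rw [Subgroup.index_map]
  exact mul_ne_zero (Subgroup.finiteIndex_of_le (H := K) le_sup_left).index_ne_zero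
    hf.index_ne_zero

lemma VirtuallyNilpotentMod.mono {N N' : Subgroup G} (h : VirtuallyNilpotentMod N)
    (hN : N ≤ N') : VirtuallyNilpotentMod N' := by
  obtain ⟨K, hK, n, hn⟩ := h
  exact ⟨K, hK, n, hn.trans hN⟩

lemma VirtuallyNilpotentMod.map {N : Subgroup G} (h : VirtuallyNilpotentMod N) (f : G →* G')
    (hf : f.range.FiniteIndex) : VirtuallyNilpotentMod (N.map f) := by
  obtain ⟨K, hK, n, hn⟩ := h
  refine ⟨K.map f, finiteIndex_map f hf K, n, ?_⟩
  rw [← Subgroup.map_lowerCentralSeries]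
  exact Subgroup.map_mono hn

lemma VirtuallyNilpotentMod.comap {N : Subgroup G'} (h : VirtuallyNilpotentMod N) (f : G →* G') :
    VirtuallyNilpotentMod (N.comap f) := by
  obtain ⟨K, hK, n, hn⟩ := h
  refine ⟨K.comap f, finiteIndex_comap f K, n, ?_⟩
  rw [← Subgroup.map_le_iff_le_comap, Subgroup.map_lowerCentralSeries]
  exact (Subgroup.lowerCentralSeries_mono n (Subgroup.map_comap_le f K)).trans hn

lemma VirtuallyNilpotentMod.exists_normal {N : Subgroup G} (h : VirtuallyNilpotentMod N) :
    ∃ K : Subgroup G, K.Normal ∧ K.FiniteIndex ∧ ∃ n, K.lowerCentralSeries n ≤ N := by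
  obtain ⟨K, hK, n, hn⟩ := h
  exact ⟨K.normalCore, inferInstance, inferInstance, n,
    (Subgroup.lowerCentralSeries_mono n K.normalCore_le).trans hn⟩

lemma range_finiteIndex_of_surjective {f : G →* G'} (hf : Function.Surjective f) :
    f.range.FiniteIndex := by
  rw [MonoidHom.range_eq_top.2 hf]
  infer_instance

lemma VirtuallyNilpotentMod.of_comap {N : Subgroup G'} {f : G →* G'}
    (hf : f.range.FiniteIndex) (h : VirtuallyNilpotentMod (N.comap f)) :
    VirtuallyNilpotentMod N :=
  (h.map f hf).mono (Subgroup.map_comap_le f N)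

lemma VirtuallyNilpotent.mod_bot (h : VirtuallyNilpotent G) :
    VirtuallyNilpotentMod (⊥ : Subgroup G) := by
  obtain ⟨K, hK, hn⟩ := h
  obtain ⟨n, hn⟩ := (Subgroup.isNilpotent_iff_lowerCentralSeries K).1 hn
  exact ⟨K, hK, n, hn.le⟩

lemma VirtuallyNilpotentMod.virtuallyNilpotent (h : VirtuallyNilpotentMod (⊥ : Subgroup G)) :
    VirtuallyNilpotent G := by
  obtain ⟨K, hK, n, hn⟩ := h
  exact ⟨K, hK, (Subgroup.isNilpotent_iff_lowerCentralSeries K).2 ⟨n, le_bot_iff.1 hn⟩⟩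

lemma MetabelianSectionsVirtuallyNilpotent.of_surjective
    (h : MetabelianSectionsVirtuallyNilpotent G) {f : G →* G'} (hf : Function.Surjective f) :
    MetabelianSectionsVirtuallyNilpotent G' := by
  intro K hK N hN hKN
  refine .of_comap (range_finiteIndex_of_surjective hf)
    (h (K.comap f) (finiteIndex_comap f K) _
      ((Subgroup.comap_mono hN).trans (Subgroup.le_normalizer_comap f)) ?_)
  rw [← Subgroup.map_le_iff_le_comap, Subgroup.map_commutator, Subgroup.map_commutator]
  have := Subgroup.map_comap_le f K
  exact (Subgroup.commutator_mono (Subgroup.commutator_mono this this)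
    (Subgroup.commutator_mono this this)).trans hKN

lemma MetabelianSectionsVirtuallyNilpotent.subgroup
    (h : MetabelianSectionsVirtuallyNilpotent G) (L : Subgroup G) [hL : L.FiniteIndex] :
    MetabelianSectionsVirtuallyNilpotent L := by
  intro K hK N hN hKN
  have h1 := h (K.map L.subtype) (finiteIndex_map _ (by rwa [Subgroup.range_subtype]) K)
    (N.map L.subtype) ((Subgroup.map_mono hN).trans (Subgroup.le_normalizer_map L.subtype)) (by
      rw [← Subgroup.map_commutator, ← Subgroup.map_commutator]
      exact Subgroup.map_mono hKN)
  have h2 := h1.comap L.subtype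
  rwa [Subgroup.comap_map_eq_self_of_injective L.subtype_injective] at h2

lemma VirtuallyNilpotentMod.of_subgroup (L : Subgroup G) [hL : L.FiniteIndex]
    (h : VirtuallyNilpotentMod (⊥ : Subgroup L)) : VirtuallyNilpotentMod (⊥ : Subgroup G) :=
  .of_comap (f := L.subtype) (by rwa [Subgroup.range_subtype]) (h.mono bot_le)

end VirtuallyNilpotentMod

section AbelianByNilpotent

variable {G : Type*} [Group G]

lemma commutator_top_le_iff (X N : Subgroup G) [N.Normal] :
    ⁅X, (⊤ : Subgroup G)⁆ ≤ N ↔ X ≤ (Subgroup.center (G ⧸ N)).comap (QuotientGroup.mk' N) := by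
  rw [← Subgroup.map_le_iff_le_comap, ← Subgroup.centralizer_univ, ← Subgroup.coe_top,
    ← Subgroup.commutator_eq_bot_iff_le_centralizer,
    ← Subgroup.map_top_of_surjective _ (QuotientGroup.mk'_surjective N), ← Subgroup.map_commutator,
    Subgroup.map_eq_bot_iff, QuotientGroup.ker_mk']

lemma commutator_commutator_le_sup (X Y Z : Subgroup G) [X.Normal] [Y.Normal] [Z.Normal] :
    ⁅⁅X, Y⁆, Z⁆ ≤ ⁅⁅X, Z⁆, Y⁆ ⊔ ⁅X, ⁅Y, Z⁆⁆ := by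
  set D := ⁅⁅X, Z⁆, Y⁆ ⊔ ⁅X, ⁅Y, Z⁆⁆
  let f := QuotientGroup.mk' D
  have hbot : ∀ S : Subgroup G, S ≤ D → S.map f = ⊥ := fun S hS => by
    rw [Subgroup.map_eq_bot_iff, QuotientGroup.ker_mk']
    exact hS
  have h1 : ⁅⁅X.map f, Y.map f⁆, Z.map f⁆ = ⊥ := by
    refine Subgroup.commutator_commutator_eq_bot_of_rotate ?_ ?_
    · rw [← Subgroup.map_commutator, ← Subgroup.map_commutator]
      exact hbot _ ((Subgroup.commutator_comm _ _).le.trans le_sup_right)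
    · rw [← Subgroup.map_commutator, ← Subgroup.map_commutator]
      exact hbot _ ((Subgroup.commutator_mono (Subgroup.commutator_comm _ _).le le_rfl).trans
        le_sup_left)
  rw [← Subgroup.map_commutator, ← Subgroup.map_commutator, Subgroup.map_eq_bot_iff,
    QuotientGroup.ker_mk'] at h1
  exact h1

/-- The subgroup generated by the commutators of two terms of the lower central series of total
weight at least `k + 2`. -/
def weightedCommutator (G : Type*) [Group G] (k : ℕ) : Subgroup G :=
  ⨆ p : {p : ℕ × ℕ // k ≤ p.1 + p.2},
    ⁅(⊤ : Subgroup G).lowerCentralSeries (p.1.1 + 1),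
      (⊤ : Subgroup G).lowerCentralSeries (p.1.2 + 1)⁆

lemma le_weightedCommutator {k : ℕ} (i j : ℕ) (h : k ≤ i + j) :
    ⁅(⊤ : Subgroup G).lowerCentralSeries (i + 1), (⊤ : Subgroup G).lowerCentralSeries (j + 1)⁆ ≤
      weightedCommutator G k :=
  le_iSup (fun p : {p : ℕ × ℕ // k ≤ p.1 + p.2} =>
    ⁅(⊤ : Subgroup G).lowerCentralSeries (p.1.1 + 1),
      (⊤ : Subgroup G).lowerCentralSeries (p.1.2 + 1)⁆) ⟨(i, j), h⟩

lemma commutator_weightedCommutator_le (k : ℕ) :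
    ⁅weightedCommutator G k, (⊤ : Subgroup G)⁆ ≤ weightedCommutator G (k + 1) := by
  have hn : (weightedCommutator G (k + 1)).Normal := Subgroup.iSup_normal _
  rw [commutator_top_le_iff]
  refine iSup_le fun ⟨⟨i, j⟩, hp⟩ => ?_
  rw [← commutator_top_le_iff]
  simp only at hp
  refine (commutator_commutator_le_sup _ _ _).trans (sup_le ?_ ?_)
  · exact le_weightedCommutator (i + 1) j (by omega)
  · exact le_weightedCommutator i (j + 1) (by omega)

lemma weightedCommutator_eq_bot {c : ℕ}
    (h : ⁅(⊤ : Subgroup G).lowerCentralSeries c, commutator G⁆ = ⊥) :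
    weightedCommutator G (2 * c) = ⊥ := by
  refine le_bot_iff.1 (iSup_le fun ⟨⟨i, j⟩, hp⟩ => ?_)
  have hle : ∀ i, (⊤ : Subgroup G).lowerCentralSeries (i + 1) ≤ commutator G := fun i => by
    rw [← Subgroup.top_lowerCentralSeries_one]
    exact Subgroup.lowerCentralSeries_antitone _ (by omega)
  have hc : ∀ i, c ≤ i → (⊤ : Subgroup G).lowerCentralSeries (i + 1) ≤
      (⊤ : Subgroup G).lowerCentralSeries c := fun i hi =>
    Subgroup.lowerCentralSeries_antitone _ (by omega)
  rw [← h]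
  by_cases hi : c ≤ i
  · exact Subgroup.commutator_mono (hc i hi) (hle j)
  · rw [Subgroup.commutator_comm]
    exact Subgroup.commutator_mono (hc j (by simp only at hp; omega)) (hle i)

lemma virtuallyNilpotent_of_commutator_acts_trivially
    (hG : MetabelianSectionsVirtuallyNilpotent G) {c : ℕ}
    (h : ⁅(⊤ : Subgroup G).lowerCentralSeries c, commutator G⁆ = ⊥) :
    VirtuallyNilpotentMod (⊥ : Subgroup G) := by
  obtain ⟨K, hK, n, hn⟩ := hG ⊤ inferInstance ⁅⁅⊤, ⊤⁆, ⁅⊤, ⊤⁆⁆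
    (by rw [Subgroup.normalizer_eq_top_iff.2 inferInstance]) le_rfl
  have h0 : ⁅⁅(⊤ : Subgroup G), ⊤⁆, ⁅⊤, ⊤⁆⁆ ≤ weightedCommutator G 0 :=
    le_weightedCommutator 0 0 le_rfl
  have key : ∀ i, K.lowerCentralSeries (n + i) ≤ weightedCommutator G i := by
    intro i
    induction i with
    | zero => exact hn.trans h0
    | succ i ih =>
      rw [← add_assoc, Subgroup.lowerCentralSeries_succ]
      exact (Subgroup.commutator_mono ih le_top).trans (commutator_weightedCommutator_le i)
  exact ⟨K, hK, n + 2 * c, (key (2 * c)).trans (weightedCommutator_eq_bot h).le⟩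

end AbelianByNilpotent

section ConjugationModule

open scoped IsMulCommutative commutatorElement

variable {G : Type*} [Group G] (A : Subgroup G) [IsMulCommutative A]

/-- The subgroup of `G` underlying a submodule of the abelian normal subgroup `A`. -/
def subgroupOfSubmodule (L : Submodule ℤ (Additive A)) : Subgroup G where
  carrier := {g | ∃ a ∈ L, (a.toMul : G) = g}
  one_mem' := ⟨0, L.zero_mem, rfl⟩
  mul_mem' := by
    rintro _ _ ⟨a, ha, rfl⟩ ⟨b, hb, rfl⟩
    exact ⟨a + b, L.add_mem ha hb, rfl⟩
  inv_mem' := by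
    rintro _ ⟨a, ha, rfl⟩
    exact ⟨-a, L.neg_mem ha, rfl⟩

/-- The submodule of the abelian normal subgroup `A` given by the elements of a subgroup. -/
def submoduleOfSubgroup (N : Subgroup G) : Submodule ℤ (Additive A) :=
  AddSubgroup.toIntSubmodule
    { carrier := {a | (a.toMul : G) ∈ N}
      zero_mem' := N.one_mem
      add_mem' := fun ha hb => N.mul_mem ha hb
      neg_mem' := fun ha => N.inv_mem ha }

variable {A}

lemma coe_mem_subgroupOfSubmodule {L : Submodule ℤ (Additive A)} {a : Additive A} :
    (a.toMul : G) ∈ subgroupOfSubmodule A L ↔ a ∈ L := by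
  constructor
  · rintro ⟨b, hb, hba⟩
    have : b = a := Additive.toMul.injective (Subtype.ext hba)
    exact this ▸ hb
  · exact fun ha => ⟨a, ha, rfl⟩

lemma subgroupOfSubmodule_le (L : Submodule ℤ (Additive A)) : subgroupOfSubmodule A L ≤ A := by
  rintro _ ⟨a, _, rfl⟩
  exact a.toMul.2

lemma subgroupOfSubmodule_submoduleOfSubgroup {N : Subgroup G} (hN : N ≤ A) :
    subgroupOfSubmodule A (submoduleOfSubgroup A N) = N := by
  ext g
  constructor
  · rintro ⟨a, ha, rfl⟩
    exact ha
  · exact fun hg => ⟨Additive.ofMul ⟨g, hN hg⟩, hg, rfl⟩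

variable [A.Normal]

variable (A) in
/-- The action by conjugation on an abelian normal subgroup, as a representation of the group of
automorphisms it induces. -/
def conjRepresentation :
    Representation ℤ (MulAut.conjNormal : G →* MulAut A).range (Additive A) where
  toFun h := (MonoidHom.toAdditive (h : MulAut A).toMonoidHom).toIntLinearMap
  map_one' := rfl
  map_mul' _ _ := rfl

variable (A) in
lemma conjRepresentation_injective : Function.Injective (conjRepresentation A) := by
  intro g h hgh
  refine Subtype.ext (MulEquiv.ext fun a => ?_)
  exact Additive.ofMul.injective (LinearMap.congr_fun hgh (Additive.ofMul a))

variable (A) in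
lemma conjRepresentation_apply (g : G) (a : Additive A) :
    ((conjRepresentation A (MulAut.conjNormal.rangeRestrict g) a).toMul : G) =
      g * a.toMul * g⁻¹ := rfl

lemma isInvariantUnder_top_iff {L : Submodule ℤ (Additive A)} :
    IsInvariantUnder (conjRepresentation A) ⊤ L ↔ (subgroupOfSubmodule A L).Normal := by
  constructor
  · intro h
    refine ⟨?_⟩
    rintro _ ⟨a, ha, rfl⟩ g
    rw [← conjRepresentation_apply, coe_mem_subgroupOfSubmodule]
    exact h _ trivial a ha
  · rintro h ⟨_, g, rfl⟩ - a ha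
    have h1 := h.conj_mem _ (coe_mem_subgroupOfSubmodule.2 ha) g
    rwa [← conjRepresentation_apply, coe_mem_subgroupOfSubmodule] at h1

lemma exists_finite_orbitSpan_conjRepresentation {F : Set G} (hF : F.Finite)
    (hFA : Subgroup.normalClosure F = A) :
    ∃ F' : Set (Additive A), F'.Finite ∧ orbitSpan (conjRepresentation A) ⊤ F' = ⊤ := by
  have hinj : Function.Injective fun a : Additive A => (a.toMul : G) :=
    fun a b h => Additive.toMul.injective (Subtype.ext h)
  refine ⟨_, hF.preimage hinj.injOn, ?_⟩
  set F' := (fun a : Additive A => (a.toMul : G)) ⁻¹' F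
  have hn := isInvariantUnder_top_iff.1
    (IsInvariantUnder.orbitSpan (ρ := conjRepresentation A) (K := ⊤) F')
  rw [eq_top_iff]
  rintro a -
  rw [← coe_mem_subgroupOfSubmodule]
  refine Subgroup.normalClosure_le_normal (s := F) (fun f hf => ?_) (hFA.symm ▸ a.toMul.2)
  have hfA : f ∈ A := hFA ▸ Subgroup.subset_normalClosure hf
  exact ⟨Additive.ofMul ⟨f, hfA⟩, subset_orbitSpan (ρ := conjRepresentation A) F' hf, rfl⟩

lemma VirtuallyNilpotentMod.virtuallyUnipotentMod {L : Submodule ℤ (Additive A)}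
    (h : VirtuallyNilpotentMod (subgroupOfSubmodule A L)) :
    VirtuallyUnipotentMod (conjRepresentation A) L := by
  obtain ⟨K, hK, hKfin, n, hn⟩ := h.exists_normal
  refine ⟨K.map MulAut.conjNormal.rangeRestrict, finiteIndex_map _
    (range_finiteIndex_of_surjective (MonoidHom.rangeRestrict_surjective _)) K, n + 1, ?_⟩
  have hbr : ∀ (k : G) (a : Additive A),
      (((conjRepresentation A (MulAut.conjNormal.rangeRestrict k) a) - a).toMul : G) =
        ⁅k, (a.toMul : G)⁆ := fun k a => by
    rw [toMul_sub, div_eq_mul_inv, Subgroup.coe_mul, conjRepresentation_apply]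
    rfl
  have key : ∀ i j, i + j = n → ∀ a : Additive A, (a.toMul : G) ∈ K.lowerCentralSeries j →
      a ∈ unipotentLayer (conjRepresentation A) (K.map MulAut.conjNormal.rangeRestrict) L i := by
    intro i
    induction i with
    | zero =>
      intro j hj a ha
      obtain rfl : j = n := by omega
      exact coe_mem_subgroupOfSubmodule.1 (hn ha)
    | succ i ih =>
      intro j hj a ha
      rw [mem_unipotentLayer_succ]
      rintro _ ⟨k, hk, rfl⟩
      refine ih (j + 1) (by omega) _ ?_
      rw [hbr, Subgroup.lowerCentralSeries_succ, Subgroup.commutator_comm]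
      exact Subgroup.commutator_mem_commutator hk ha
  rw [eq_top_iff]
  rintro a -
  rw [mem_unipotentLayer_succ]
  rintro _ ⟨k, hk, rfl⟩
  refine key n 0 rfl _ ?_
  rw [hbr, Subgroup.lowerCentralSeries_zero]
  exact Subgroup.commutator_le_left K ⊤ (Subgroup.commutator_mem_commutator hk (Subgroup.mem_top _))

lemma VirtuallyUnipotentMod.virtuallyNilpotentMod {c : ℕ}
    (hc : (⊤ : Subgroup G).lowerCentralSeries c ≤ A)
    (h : VirtuallyUnipotentMod (conjRepresentation A) ⊥) :
    VirtuallyNilpotentMod (⊥ : Subgroup G) := by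
  obtain ⟨K', hK', n, hn⟩ := h
  let K := K'.comap (MulAut.conjNormal : G →* MulAut A).rangeRestrict
  refine ⟨K, finiteIndex_comap _ K', c + n, ?_⟩
  have key : ∀ i j, i + j = n → K.lowerCentralSeries (c + j) ≤
      subgroupOfSubmodule A (unipotentLayer (conjRepresentation A) K' ⊥ i) := by
    intro i j
    induction j generalizing i with
    | zero =>
      intro hi
      obtain rfl : i = n := by omega
      rw [hn]
      intro g hg
      have hgA : g ∈ A := hc (Subgroup.lowerCentralSeries_mono c le_top hg)
      exact ⟨Additive.ofMul ⟨g, hgA⟩, trivial, rfl⟩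
    | succ j ih =>
      intro hi
      rw [← add_assoc, Subgroup.lowerCentralSeries_succ, Subgroup.commutator_comm,
        Subgroup.commutator_le]
      intro k hk g hg
      obtain ⟨a, ha, rfl⟩ := ih (i + 1) (by omega) hg
      refine ⟨_, mem_unipotentLayer_succ.1 ha _ hk, ?_⟩
      rw [toMul_sub, div_eq_mul_inv, Subgroup.coe_mul, conjRepresentation_apply]
      rfl
  refine (key 0 n (zero_add n)).trans ?_
  rintro _ ⟨a, ha, rfl⟩
  rw [(Submodule.mem_bot ℤ).1 ha]
  exact Subgroup.one_mem _

end ConjugationModule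

section Reduction

open scoped IsMulCommutative commutatorElement

universe u

variable {G : Type u} [Group G]

lemma isMulCommutative_of_commutator_eq_bot {A : Subgroup G} (h : ⁅A, A⁆ = ⊥) :
    IsMulCommutative A :=
  Subgroup.le_centralizer_iff_isMulCommutative.1
    (Subgroup.commutator_eq_bot_iff_le_centralizer.1 h)

lemma ker_conjNormal_rangeRestrict (A : Subgroup G) [A.Normal] :
    (MulAut.conjNormal : G →* MulAut A).rangeRestrict.ker = Subgroup.centralizer (A : Set G) := by
  ext g
  rw [MonoidHom.ker_rangeRestrict, MonoidHom.mem_ker, Subgroup.mem_centralizer_iff]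
  constructor
  · intro h a ha
    have := congrArg Subtype.val (DFunLike.congr_fun h (⟨a, ha⟩ : A))
    rw [MulAut.conjNormal_apply, mul_inv_eq_iff_eq_mul] at this
    exact this.symm
  · intro h
    refine MulEquiv.ext fun a => Subtype.ext ?_
    rw [MulAut.conjNormal_apply, mul_inv_eq_iff_eq_mul]
    exact (h a a.2).symm

lemma isNilpotent_range_conjNormal {c : ℕ} (A : Subgroup G) [A.Normal] [hA : IsMulCommutative A]
    (hc : (⊤ : Subgroup G).lowerCentralSeries c ≤ A) :
    Group.IsNilpotent (MulAut.conjNormal : G →* MulAut A).range := by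
  refine Subgroup.nilpotent_iff_lowerCentralSeries.2 ⟨c, ?_⟩
  rw [← Subgroup.map_top_of_surjective _
      (MulAut.conjNormal : G →* MulAut A).rangeRestrict_surjective,
    ← Subgroup.map_lowerCentralSeries, Subgroup.map_eq_bot_iff, ker_conjNormal_rangeRestrict]
  exact hc.trans (Subgroup.le_centralizer_iff_isMulCommutative.2 hA)

lemma commutator_lowerCentralSeries_top_eq_bot (K : Subgroup G) {c : ℕ} {X : Subgroup K}
    (h : ⁅(⊤ : Subgroup G).lowerCentralSeries c, X.map K.subtype⁆ = ⊥) :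
    ⁅(⊤ : Subgroup K).lowerCentralSeries c, X⁆ = ⊥ := by
  rw [← Subgroup.map_subtype_inj, Subgroup.map_bot, ← le_bot_iff, Subgroup.map_commutator,
    Subgroup.top_subtype_lowerCentralSeries, ← h]
  exact Subgroup.commutator_mono (Subgroup.lowerCentralSeries_mono c le_top) le_rfl

/-- The case of an abelian term of the lower central series all of whose nontrivial normal
subgroups have virtually nilpotent quotient. -/
lemma virtuallyNilpotentMod_bot_of_minimal [Group.FG G]
    (hG : MetabelianSectionsVirtuallyNilpotent G) {c : ℕ}
    (hA : ⁅(⊤ : Subgroup G).lowerCentralSeries c, (⊤ : Subgroup G).lowerCentralSeries c⁆ = ⊥)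
    (hmin : ∀ N : Subgroup G, N.Normal → N ≤ (⊤ : Subgroup G).lowerCentralSeries c → N ≠ ⊥ →
      VirtuallyNilpotentMod N) :
    VirtuallyNilpotentMod (⊥ : Subgroup G) := by
  set A := (⊤ : Subgroup G).lowerCentralSeries c with hAdef
  have hcomm : IsMulCommutative A := isMulCommutative_of_commutator_eq_bot hA
  have hnil := isNilpotent_range_conjNormal A hAdef.ge
  have hfg : Group.FG (MulAut.conjNormal : G →* MulAut A).range := Group.fg_range _
  by_contra hbot
  obtain ⟨F₀, hF₀, hF₀A⟩ := exists_finite_normalClosure_eq_lowerCentralSeries (H := G) c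
  obtain ⟨F, hF, hFtop⟩ := exists_finite_orbitSpan_conjRepresentation hF₀ (A := A) hF₀A
  have hcenter := finiteIndex_center_of_minimal (conjRepresentation_injective A) hF hFtop
    (fun B hB hB0 => by
      refine (hmin _ (isInvariantUnder_top_iff.1 hB) (subgroupOfSubmodule_le B)
        fun h => hB0 ?_).virtuallyUnipotentMod
      rw [eq_bot_iff]
      intro b hb
      have h1 := coe_mem_subgroupOfSubmodule.2 hb
      rw [h, Subgroup.mem_bot] at h1
      exact Additive.toMul.injective (Subtype.ext h1))
    (fun h => hbot (h.virtuallyNilpotentMod hAdef.ge))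
  let π := (MulAut.conjNormal : G →* MulAut A).rangeRestrict
  let K := (Subgroup.center (MulAut.conjNormal : G →* MulAut A).range).comap π
  have hK : K.FiniteIndex := finiteIndex_comap π _
  refine hbot (.of_subgroup K (virtuallyNilpotent_of_commutator_acts_trivially (c := c)
    (hG.subgroup K) (commutator_lowerCentralSeries_top_eq_bot K ?_)))
  rw [Subgroup.map_subtype_commutator, Subgroup.commutator_comm,
    Subgroup.commutator_eq_bot_iff_le_centralizer, ← ker_conjNormal_rangeRestrict,
    ← Subgroup.map_eq_bot_iff, Subgroup.map_commutator,
    Subgroup.commutator_eq_bot_iff_le_centralizer]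
  exact (Subgroup.map_comap_le π _).trans (Subgroup.center_le_centralizer _)

lemma exists_maximal_normal_not_virtuallyNilpotentMod [Group.FG G] {c : ℕ}
    (hA : ⁅(⊤ : Subgroup G).lowerCentralSeries c, (⊤ : Subgroup G).lowerCentralSeries c⁆ = ⊥)
    (hbot : ¬ VirtuallyNilpotentMod (⊥ : Subgroup G)) :
    ∃ B : Subgroup G, B.Normal ∧ B ≤ (⊤ : Subgroup G).lowerCentralSeries c ∧
      ¬ VirtuallyNilpotentMod B ∧ ∀ N : Subgroup G, N.Normal →
        N ≤ (⊤ : Subgroup G).lowerCentralSeries c → B < N → VirtuallyNilpotentMod N := by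
  set A := (⊤ : Subgroup G).lowerCentralSeries c with hAdef
  have hcomm : IsMulCommutative A := isMulCommutative_of_commutator_eq_bot hA
  have hnil := isNilpotent_range_conjNormal A hAdef.ge
  have hfg : Group.FG (MulAut.conjNormal : G →* MulAut A).range := Group.fg_range _
  obtain ⟨F₀, hF₀, hF₀A⟩ := exists_finite_normalClosure_eq_lowerCentralSeries (H := G) c
  obtain ⟨F, hF, hFtop⟩ := exists_finite_orbitSpan_conjRepresentation hF₀ (A := A) hF₀A
  have hacc := invariantACC_orbitSpan (conjRepresentation A) isPolycyclic_top hF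
  rw [hFtop] at hacc
  have : WellFoundedGT {L : Submodule ℤ (Additive A) //
    IsInvariantUnder (conjRepresentation A) ⊤ L ∧ L ≤ ⊤} := hacc
  have hinv : ∀ N : Subgroup G, N.Normal → N ≤ A →
      IsInvariantUnder (conjRepresentation A) ⊤ (submoduleOfSubgroup A N) := fun N hN hNA => by
    rwa [isInvariantUnder_top_iff, subgroupOfSubmodule_submoduleOfSubgroup hNA]
  obtain ⟨⟨B, hB, _⟩, hBn, hmax⟩ := (wellFounded_gt (α := {L : Submodule ℤ (Additive A) //
    IsInvariantUnder (conjRepresentation A) ⊤ L ∧ L ≤ ⊤})).has_min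
    {L | ¬ VirtuallyNilpotentMod (subgroupOfSubmodule A L.1)}
    ⟨⟨submoduleOfSubgroup A ⊥, hinv ⊥ inferInstance bot_le, le_top⟩, by
      rwa [Set.mem_ofPred_eq, subgroupOfSubmodule_submoduleOfSubgroup bot_le]⟩
  refine ⟨subgroupOfSubmodule A B, isInvariantUnder_top_iff.1 hB, subgroupOfSubmodule_le B, hBn,
    fun N hN hNA hBN => ?_⟩
  by_contra hN'
  refine hmax ⟨submoduleOfSubgroup A N, hinv N hN hNA, le_top⟩ ?_ ?_
  · rwa [Set.mem_ofPred_eq, subgroupOfSubmodule_submoduleOfSubgroup hNA]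
  · change B < submoduleOfSubgroup A N
    refine lt_of_le_of_ne (fun b hb => hBN.le (coe_mem_subgroupOfSubmodule.2 hb)) ?_
    rintro rfl
    rw [subgroupOfSubmodule_submoduleOfSubgroup hNA] at hBN
    exact hBN.ne rfl

lemma virtuallyNilpotentMod_bot_of_abelian_lowerCentralSeries [Group.FG G]
    (hG : MetabelianSectionsVirtuallyNilpotent G) {c : ℕ}
    (hA : ⁅(⊤ : Subgroup G).lowerCentralSeries c, (⊤ : Subgroup G).lowerCentralSeries c⁆ = ⊥) :
    VirtuallyNilpotentMod (⊥ : Subgroup G) := by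
  by_contra hbot
  obtain ⟨B, hBn, hBA, hB, hmax⟩ := exists_maximal_normal_not_virtuallyNilpotentMod hA hbot
  have hf := QuotientGroup.mk'_surjective B
  have hlcs : (⊤ : Subgroup (G ⧸ B)).lowerCentralSeries c =
      ((⊤ : Subgroup G).lowerCentralSeries c).map (QuotientGroup.mk' B) := by
    rw [Subgroup.map_lowerCentralSeries, Subgroup.map_top_of_surjective _ hf]
  have hfg : Group.FG (G ⧸ B) := Group.fg_of_surjective hf
  have key : VirtuallyNilpotentMod (⊥ : Subgroup (G ⧸ B)) := by
    refine virtuallyNilpotentMod_bot_of_minimal (c := c) (hG.of_surjective hf) ?_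
      fun N hN hNA hN0 => ?_
    · rw [hlcs, ← Subgroup.map_commutator, hA, Subgroup.map_bot]
    · have hle : B ≤ N.comap (QuotientGroup.mk' B) := by
        conv_lhs => rw [← QuotientGroup.ker_mk' B]
        exact Subgroup.ker_le_comap _ N
      refine .of_comap (range_finiteIndex_of_surjective hf) (hmax _ (hN.comap _) ?_
        (lt_of_le_of_ne hle fun h => hN0 ?_))
      · rw [hlcs] at hNA
        refine (Subgroup.comap_mono hNA).trans ?_
        rw [Subgroup.comap_map_eq, QuotientGroup.ker_mk']
        exact sup_le le_rfl hBA
      · rw [← Subgroup.map_comap_eq_self_of_surjective hf N, ← h, Subgroup.map_eq_bot_iff,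
          QuotientGroup.ker_mk']
  refine hB ?_
  have := key.comap (QuotientGroup.mk' B)
  rwa [MonoidHom.comap_bot, QuotientGroup.ker_mk'] at this

lemma derivedSeries_quotient_eq_bot (N : Subgroup G) [N.Normal] {n : ℕ}
    (h : derivedSeries G n ≤ N) : derivedSeries (G ⧸ N) n = ⊥ := by
  rw [← map_derivedSeries_eq (QuotientGroup.mk'_surjective N), Subgroup.map_eq_bot_iff,
    QuotientGroup.ker_mk']
  exact h

lemma virtuallyNilpotentMod_bot_of_derivedSeries_eq_bot (n : ℕ) :
    ∀ (G : Type u) [Group G] [Group.FG G], MetabelianSectionsVirtuallyNilpotent G →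
      derivedSeries G n = ⊥ → VirtuallyNilpotentMod (⊥ : Subgroup G) := by
  induction n with
  | zero => exact fun G _ _ _ h => ⟨⊤, inferInstance, 0, h.le⟩
  | succ n ih =>
    intro G _ _ hG h
    have hf := QuotientGroup.mk'_surjective (derivedSeries G n)
    have hfg : Group.FG (G ⧸ derivedSeries G n) := Group.fg_of_surjective hf
    have h1 := (ih _ (hG.of_surjective hf) (derivedSeries_quotient_eq_bot _ le_rfl)).comap
      (QuotientGroup.mk' (derivedSeries G n))
    rw [MonoidHom.comap_bot, QuotientGroup.ker_mk'] at h1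
    obtain ⟨K, hK, c, hc⟩ := h1
    refine .of_subgroup K (virtuallyNilpotentMod_bot_of_abelian_lowerCentralSeries (c := c)
      (hG.subgroup K) ?_)
    rw [← Subgroup.map_subtype_inj, Subgroup.map_bot, ← le_bot_iff, Subgroup.map_commutator,
      Subgroup.top_subtype_lowerCentralSeries, ← h, derivedSeries_succ]
    exact Subgroup.commutator_mono hc hc

lemma metabelianSectionsVirtuallyNilpotent_of_quotients
    (h : ∀ K : Subgroup G, K.FiniteIndex → ∀ (N : Subgroup K) (_ : N.Normal),
      derivedSeries (K ⧸ N) 2 = ⊥ → VirtuallyNilpotent (K ⧸ N)) :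
    MetabelianSectionsVirtuallyNilpotent G := by
  intro K hK N hN hKN
  have hn : (N.subgroupOf K).Normal := Subgroup.normal_subgroupOf_of_le_normalizer hN
  have hd : derivedSeries K 2 ≤ N.subgroupOf K := by
    rw [Subgroup.subgroupOf, ← Subgroup.map_le_iff_le_comap, derivedSeries_succ,
      Subgroup.map_commutator, derivedSeries_one, Subgroup.map_subtype_commutator]
    exact hKN
  have h1 := (h K hK _ hn (derivedSeries_quotient_eq_bot _ hd)).mod_bot.comap (QuotientGroup.mk' _)
  rw [MonoidHom.comap_bot, QuotientGroup.ker_mk'] at h1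
  exact .of_comap (f := K.subtype) (by rwa [Subgroup.range_subtype]) h1

end Reduction

/-- Every finitely generated solvable group `R` that is not virtually nilpotent contains a
subgroup `R'` of finite index which admits a metabelian quotient `Q'` that is not virtually
nilpotent. -/
theorem solvable_not_virtNilpotent_exists_metabelian_quotient
    (R : Type*) [Group R] (hfg : Group.FG R) (hsolv : IsSolvable R)
    (hnvn : ¬ VirtuallyNilpotent R) :
    ∃ R' : Subgroup R, R'.FiniteIndex ∧
      ∃ (N : Subgroup ↥R') (hN : N.Normal),
        letI := hN
        derivedSeries (↥R' ⧸ N) 2 = ⊥ ∧ ¬ VirtuallyNilpotent (↥R' ⧸ N) := by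
  by_contra hcon
  obtain ⟨n, hn⟩ := hsolv.solvable
  refine hnvn (virtuallyNilpotentMod_bot_of_derivedSeries_eq_bot n R
    (metabelianSectionsVirtuallyNilpotent_of_quotients fun K hK N hN hd => ?_)
    hn).virtuallyNilpotent
  by_contra hv
  exact hcon ⟨K, hK, N, hN, hd, hv⟩
end

section
/- Let G be a group whose abelianization G_ab = G/DG is finitely generated, and let K be a normal subgroup of G generated by a set of elements of finite order of G. Then there exists a normal subgroup G' of G of finite index such that the quotient G/G' is abelian (equivalently DG ⊆ G') and K ∩ G' ⊆ DG. (Lemme 3.4, assertion 2.) -/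
/-- A finitely generated abelian group has a torsion-free subgroup of finite index. -/
theorem CommGroup.exists_finiteIndex_forall_isOfFinOrder_eq_one (A : Type*) [CommGroup A]
    [Group.FG A] :
    ∃ N : Subgroup A, N.FiniteIndex ∧ ∀ a ∈ N, IsOfFinOrder a → a = 1 := by
  obtain ⟨ι, j, _, _, p, hp, e, ⟨f⟩⟩ := CommGroup.equiv_free_prod_prod_multiplicative_zmod A
  have (i : ι) : NeZero (p i ^ e i) := ⟨pow_ne_zero _ (hp i).ne_zero⟩
  have (i : ι) : Finite (Multiplicative (ZMod (p i ^ e i))) :=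
    inferInstanceAs (Finite (ZMod (p i ^ e i)))
  refine ⟨((MonoidHom.snd _ _).comp f.toMonoidHom).ker, inferInstance, fun a ha hfin => ?_⟩
  have hfst : (f a).1 = 1 := by
    obtain ⟨n, hn, h⟩ := isOfFinOrder_iff_pow_eq_one.mp hfin
    have hpow : (f a).1 ^ n = 1 := by rw [← Prod.pow_fst, ← map_pow, h, map_one, Prod.fst_one]
    exact (pow_eq_one_iff_left hn.ne').mp hpow
  exact f.map_eq_one_iff.mp (Prod.ext hfst ha)

/-- Let `G` be a group with finitely generated abelianization and `K` a normal subgroup of `G`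
generated by a set of elements of finite order.  Then there exists a normal finite-index subgroup
`G'` of `G` with `G/G'` abelian (i.e. `DG ⊆ G'`) such that `K ∩ G' ⊆ DG`. -/
theorem torsion_generated_normal_subgroup_avoiding_finite_index_subgroup
    (G : Type*) [Group G] (hfg : Group.FG (Abelianization G))
    (K : Subgroup G) (hKnormal : K.Normal)
    (S : Set G) (hgen : K = Subgroup.closure S) (htors : ∀ s ∈ S, IsOfFinOrder s) :
    ∃ G' : Subgroup G, G'.Normal ∧ G'.FiniteIndex ∧ commutator G ≤ G' ∧
      K ⊓ G' ≤ commutator G := by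
  obtain ⟨N, hN, htf⟩ :=
    CommGroup.exists_finiteIndex_forall_isOfFinOrder_eq_one (Abelianization G)
  have hK : K ≤ (CommGroup.torsion (Abelianization G)).comap Abelianization.of := by
    rw [hgen, Subgroup.closure_le]
    exact fun s hs => Abelianization.of.isOfFinOrder (htors s hs)
  refine ⟨N.comap Abelianization.of, inferInstance, ⟨?_⟩, ?_, ?_⟩
  · have hsurj : Function.Surjective (Abelianization.of (G := G)) := QuotientGroup.mk_surjective
    rw [N.index_comap_of_surjective hsurj]
    exact hN.index_ne_zero
  · rw [← Abelianization.ker_of]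
    exact Subgroup.ker_le_comap _ _
  · rintro x ⟨hxK, hxN⟩
    rw [← Abelianization.ker_of]
    exact htf _ hxN (hK hxK)
end

section
/- Let G be a group and L a finitely generated normal subgroup of G such that the extension splits: there is a subgroup S of G with S ∩ L = {1} and S·L = G (G is the internal semidirect product of S and L). Then L is residually finite in G: for every subgroup L' of finite index in L there exists a subgroup G' of finite index in G with G' ∩ L ⊆ L'. (Exemple 5.6.2 and the group-theoretic content of Lemme 5.8.) -/
/-- There are only finitely many homomorphisms from a finitely generated group to a finite group. -/
theorem MonoidHom.finite_of_group_fg (H P : Type*) [Group H] [Group P] [Group.FG H] [Finite P] :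
    Finite (H →* P) := by
  obtain ⟨s, hs⟩ := (Group.fg_def (G := H)).mp inferInstance
  refine Finite.of_injective (fun (f : H →* P) (x : s) => f x) fun f g hfg => ?_
  exact MonoidHom.eq_of_eqOn_dense hs fun x hx => congrFun hfg ⟨x, hx⟩

/-- A finite-index subgroup of a finitely generated group contains a characteristic subgroup
of finite index. -/
theorem Subgroup.exists_characteristic_finiteIndex_le {H : Type*} [Group H] [Group.FG H]
    (K : Subgroup H) [K.FiniteIndex] :
    ∃ N : Subgroup H, N.Characteristic ∧ N.FiniteIndex ∧ N ≤ K := by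
  have := MonoidHom.finite_of_group_fg H (Equiv.Perm (H ⧸ K))
  refine ⟨⨅ f : H →* Equiv.Perm (H ⧸ K), f.ker, ?_, ?_, ?_⟩
  · refine Subgroup.characteristic_iff_le_comap.mpr fun φ x hx => ?_
    simp only [Subgroup.mem_comap, Subgroup.mem_iInf, MonoidHom.mem_ker] at hx ⊢
    exact fun f => hx (f.comp φ.toMonoidHom)
  · exact Subgroup.finiteIndex_iInf fun f => inferInstance
  · refine (iInf_le _ (MulAction.toPermHom H (H ⧸ K))).trans ?_
    rw [← Subgroup.normalCore_eq_ker]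
    exact K.normalCore_le

/-- If a normal subgroup `L` and a subgroup `H` generate `G` and `H ∩ L` has finite index in `L`,
then `H` has finite index in `G`. -/
theorem Subgroup.finiteIndex_of_sup_eq_top {G : Type*} [Group G] (L H : Subgroup G) [L.Normal]
    (hsup : L ⊔ H = ⊤) [(H.subgroupOf L).FiniteIndex] : H.FiniteIndex := by
  let f : L ⧸ H.subgroupOf L → G ⧸ H :=
    Quotient.map' (fun l : L => (l : G)) fun a b hab => by
      rw [QuotientGroup.leftRel_apply] at hab ⊢
      exact Subgroup.mem_subgroupOf.mp hab
  have hf : Function.Surjective f := fun q => by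
    induction q using QuotientGroup.induction_on with
    | H g =>
      obtain ⟨l, hl, h, hh, rfl⟩ :=
        Subgroup.mem_sup_of_normal_left.mp (hsup ▸ Subgroup.mem_top g : g ∈ L ⊔ H)
      exact ⟨QuotientGroup.mk ⟨l, hl⟩, (QuotientGroup.mk_mul_of_mem l hh).symm⟩
  have := Finite.of_surjective f hf
  exact Subgroup.finiteIndex_of_finite_quotient

/-- Let `L` be a finitely generated normal subgroup of `G` such that the extension
`1 → L → G → G/L → 1` splits: there is a subgroup `S` of `G` with `S ∩ L = {1}` and `S·L = G`.
Then `L` is residually finite in `G`: for every finite-index subgroup `L'` of `L` there is a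
finite-index subgroup `G'` of `G` with `G' ∩ L ⊆ L'`. -/
theorem residually_finite_in_ambient_of_split
    {G : Type*} [Group G] (L : Subgroup G) [L.Normal] (hfg : Group.FG ↥L)
    (S : Subgroup G) (hdisj : S ⊓ L = ⊥) (hgen : S ⊔ L = ⊤) :
    ∀ L' : Subgroup ↥L, L'.FiniteIndex →
      ∃ G' : Subgroup G, G'.FiniteIndex ∧ G'.subgroupOf L ≤ L' := by
  intro L' _
  obtain ⟨N, hchar, hfin, hle⟩ := L'.exists_characteristic_finiteIndex_le
  have hnormal : (N.map L.subtype).Normal := inferInstance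
  refine ⟨S ⊔ N.map L.subtype, ?_, fun x hx => hle ?_⟩
  · have hNle : N ≤ (S ⊔ N.map L.subtype).subgroupOf L :=
      Subgroup.map_le_iff_le_comap.mp le_sup_right
    have htop : L ⊔ (S ⊔ N.map L.subtype) = ⊤ :=
      top_unique (hgen ▸ sup_le (le_sup_left.trans le_sup_right) le_sup_left)
    have := Subgroup.finiteIndex_of_le hNle
    exact Subgroup.finiteIndex_of_sup_eq_top L _ htop
  · obtain ⟨s, hs, _, ⟨n, hn, rfl⟩, hsn⟩ :=
      Subgroup.mem_sup_of_normal_right.mp (Subgroup.mem_subgroupOf.mp hx)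
    have hsL : s ∈ L := by
      rw [eq_mul_inv_of_mul_eq hsn]
      exact L.mul_mem x.2 (L.inv_mem n.2)
    have hs1 : s = 1 := Subgroup.mem_bot.mp (hdisj ▸ Subgroup.mem_inf.mpr ⟨hs, hsL⟩)
    rw [hs1, one_mul] at hsn
    exact Subtype.ext hsn ▸ hn
end
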